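/- The extended-model function V(·,·;σ₁,σ₂) is twice continuously differentiable on (0,∞)², extends continuously to [0,∞)² with value 0 on the coordinate axes, and on (0,∞)² it solves the Hamilton–Jacobi–Bellman equation (σ₁²/2)V_xx + (σ₂²/2)V_yy + σ₁σ₂V_xy + max over a ∈ [−δσ₁, μ̄+δσ₂] of (a·V_x + (μ̄−a)·V_y) = 0. -/

import Mathlib

open MeasureTheory Set Filter

noncomputable def Phi (z : ℝ) : ℝ :=
  (Real.sqrt (2 * Real.pi))⁻¹ * ∫ u in Set.Iio z, Real.exp (-(u ^ 2) / 2)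

/-- The explicit formula for the value function of the extended model in the region
`y > (σ₂/σ₁) x`, with `N`, `A`, `B`, `C` as in the paper. -/
noncomputable def VformE (μ δ σ₁ σ₂ x y : ℝ) : ℝ :=
  Phi ((δ * σ₂ * x + (μ + δ * σ₂) * y)
      / Real.sqrt (σ₂ * (σ₁ * y - σ₂ * x) * (μ + δ * (σ₁ + σ₂))))
    - Real.exp (-(2 * μ * (x + y)) / (σ₁ + σ₂) ^ 2)
      * Phi (((2 * μ + δ * (σ₁ + σ₂)) * σ₂ * x + ((μ + δ * σ₂) * (σ₁ + σ₂) - 2 * μ * σ₁) * y)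
        / ((σ₁ + σ₂) * Real.sqrt (σ₂ * (σ₁ * y - σ₂ * x) * (μ + δ * (σ₁ + σ₂)))))
    - Real.exp (-(2 * (μ + δ * σ₂) * x) / σ₁ ^ 2)
      * Phi (((μ + δ * σ₂) * y - (2 * μ + δ * (σ₁ + σ₂) + δ * σ₂) * (σ₂ / σ₁) * x)
        / Real.sqrt (σ₂ * (σ₁ * y - σ₂ * x) * (μ + δ * (σ₁ + σ₂))))
    + Real.exp (-(2 * μ * y) / (σ₁ + σ₂) ^ 2
          - 2 * σ₂ * x / σ₁ ^ 2 * (μ * σ₂ / (σ₁ + σ₂) ^ 2 + δ))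
      * Phi ((((μ + δ * σ₂) * (σ₁ + σ₂) - 2 * μ * σ₁) * y
            - (δ * σ₁ ^ 2 + 3 * δ * σ₁ * σ₂ + 2 * (μ + δ * σ₂) * σ₂) * (σ₂ / σ₁) * x)
        / ((σ₁ + σ₂) * Real.sqrt (σ₂ * (σ₁ * y - σ₂ * x) * (μ + δ * (σ₁ + σ₂)))))

open Classical in
/-- The explicit value function of the extended model. -/
noncomputable def Vext (μ δ σ₁ σ₂ x y : ℝ) : ℝ :=
  if σ₂ / σ₁ * x < y then VformE μ δ σ₁ σ₂ x y
  else if y < σ₂ / σ₁ * x then VformE μ δ σ₂ σ₁ y x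
  else 1 - Real.exp (-(2 * μ * x) / (σ₁ * (σ₁ + σ₂)))

/-- Partial derivative of `Vext` in `x`. -/
noncomputable def VxE (μ δ σ₁ σ₂ x y : ℝ) : ℝ := deriv (fun x' => Vext μ δ σ₁ σ₂ x' y) x

/-- Partial derivative of `Vext` in `y`. -/
noncomputable def VyE (μ δ σ₁ σ₂ x y : ℝ) : ℝ := deriv (fun y' => Vext μ δ σ₁ σ₂ x y') y

/-- Second partial derivative of `Vext` in `x`. -/
noncomputable def VxxE (μ δ σ₁ σ₂ x y : ℝ) : ℝ := deriv (fun x' => VxE μ δ σ₁ σ₂ x' y) x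

/-- Second partial derivative of `Vext` in `y`. -/
noncomputable def VyyE (μ δ σ₁ σ₂ x y : ℝ) : ℝ := deriv (fun y' => VyE μ δ σ₁ σ₂ x y') y

/-- Mixed second partial derivative of `Vext`. -/
noncomputable def VxyE (μ δ σ₁ σ₂ x y : ℝ) : ℝ := deriv (fun y' => VxE μ δ σ₁ σ₂ x y') y


noncomputable def phiG (z : ℝ) : ℝ := (Real.sqrt (2 * Real.pi))⁻¹ * Real.exp (-(z ^ 2) / 2)

lemma phiG_pos (z : ℝ) : 0 < phiG z := by
  unfold phiG; positivity

lemma gInt : Integrable (fun u : ℝ => Real.exp (-(u ^ 2) / 2)) := by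
  have := integrable_exp_neg_mul_sq (b := 1 / 2) (by norm_num)
  refine this.congr (Eventually.of_forall fun u => ?_)
  simp only; congr 1; ring

lemma gCont : Continuous (fun u : ℝ => Real.exp (-(u ^ 2) / 2)) := by fun_prop

lemma Phi_Iic (z : ℝ) : Phi z = (Real.sqrt (2 * Real.pi))⁻¹ * ∫ u in Set.Iic z, Real.exp (-(u ^ 2) / 2) := by
  unfold Phi; rw [integral_Iic_eq_integral_Iio]

lemma hasDerivAt_Phi (z : ℝ) : HasDerivAt Phi (phiG z) z := by
  have h1 : Phi = fun z => (Real.sqrt (2 * Real.pi))⁻¹ *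
      ((∫ u in Set.Iic (0:ℝ), Real.exp (-(u ^ 2) / 2)) + ∫ u in (0:ℝ)..z, Real.exp (-(u ^ 2) / 2)) := by
    funext z
    rw [Phi_Iic, ← intervalIntegral.integral_Iic_sub_Iic gInt.integrableOn gInt.integrableOn]
    ring
  rw [h1]
  unfold phiG
  refine HasDerivAt.const_mul _ (HasDerivAt.const_add _ ?_)
  exact intervalIntegral.integral_hasDerivAt_right (gCont.intervalIntegrable _ _)
    (gCont.stronglyMeasurableAtFilter _ _) gCont.continuousAt

lemma hasDerivAt_phiG (z : ℝ) : HasDerivAt phiG (-z * phiG z) z := by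
  unfold phiG
  have h : HasDerivAt (fun z : ℝ => -(z ^ 2) / 2) (-z) z := by
    have := ((hasDerivAt_pow 2 z).neg.div_const 2)
    refine this.congr_deriv ?_
    simp; ring
  refine (h.exp.const_mul _).congr_deriv ?_
  ring

lemma phiG_contDiff : ContDiff ℝ 2 phiG := by
  unfold phiG; fun_prop

lemma Phi_contDiff : ContDiff ℝ 2 Phi := by
  have hd : deriv Phi = phiG := funext fun z => (hasDerivAt_Phi z).deriv
  have : ContDiff ℝ (1 + 1) Phi := by
    rw [contDiff_succ_iff_deriv]
    refine ⟨fun z => (hasDerivAt_Phi z).differentiableAt, by simp, ?_⟩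
    rw [hd]; exact phiG_contDiff.of_le (by norm_num)
  exact this.of_le (by norm_num)

lemma Phi_continuous : Continuous Phi := Phi_contDiff.continuous

lemma Phi_nonneg (z : ℝ) : 0 ≤ Phi z := by
  unfold Phi
  exact mul_nonneg (by positivity) (integral_nonneg fun u => (Real.exp_pos _).le)

lemma Phi_tendsto : Tendsto Phi atBot (nhds 0) := by
  have := (tendsto_integral_Iic_zero (f := fun u : ℝ => Real.exp (-(u ^ 2) / 2)) (μ := volume)
    (a := id) (l := atBot) tendsto_id).const_mul (Real.sqrt (2 * Real.pi))⁻¹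
  rw [mul_zero] at this
  exact this.congr fun z => (Phi_Iic z).symm

lemma Phi_neg (z : ℝ) : Phi (-z) = 1 - Phi z := by
  have hs : (∫ u : ℝ, Real.exp (-(u ^ 2) / 2)) = Real.sqrt (2 * Real.pi) := by
    have := integral_gaussian (1 / 2)
    rw [show Real.pi / (1 / 2) = 2 * Real.pi by ring] at this
    rw [← this]; congr 1; funext u; congr 1; ring
  have h2 : (∫ u in Set.Iic (-z), Real.exp (-(u ^ 2) / 2)) = ∫ u in Set.Ioi z, Real.exp (-(u ^ 2) / 2) := by
    have := integral_comp_neg_Iic (-z) (fun u : ℝ => Real.exp (-(u ^ 2) / 2))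
    simpa using this
  have h3 := intervalIntegral.integral_Iic_add_Ioi (b := z) (f := fun u : ℝ => Real.exp (-(u ^ 2) / 2)) (μ := volume)
    gInt.integrableOn gInt.integrableOn
  have hp : Real.sqrt (2 * Real.pi) ≠ 0 := by positivity
  rw [Phi_Iic, Phi_Iic, h2]
  have h4 : (∫ u in Set.Ioi z, Real.exp (-(u ^ 2) / 2))
      = Real.sqrt (2 * Real.pi) - ∫ u in Set.Iic z, Real.exp (-(u ^ 2) / 2) := by linarith
  rw [h4, mul_sub, inv_mul_cancel₀ hp]

lemma nonneg_of_deriv {f f' : ℝ → ℝ} (hf : ∀ z, HasDerivAt f (f' z) z) (h0 : ∀ z, 0 ≤ f' z)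
    (ht : Tendsto f atBot (nhds 0)) (z : ℝ) : 0 ≤ f z := by
  have hm : Monotone f := monotone_of_deriv_nonneg (fun z => (hf z).differentiableAt)
    (fun z => by rw [(hf z).deriv]; exact h0 z)
  exact hm.le_of_tendsto ht z

lemma phiG_le (z : ℝ) : phiG z ≤ (Real.sqrt (2 * Real.pi))⁻¹ * Real.exp (1 / 2) * Real.exp z := by
  unfold phiG
  rw [mul_assoc, ← Real.exp_add]
  have : -(z ^ 2) / 2 ≤ 1 / 2 + z := by nlinarith [sq_nonneg (z + 1)]
  gcongr

lemma Phi_le (z : ℝ) : Phi z ≤ (Real.sqrt (2 * Real.pi))⁻¹ * Real.exp (1 / 2) * Real.exp z := by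
  have := nonneg_of_deriv (f := fun z => (Real.sqrt (2 * Real.pi))⁻¹ * Real.exp (1 / 2) * Real.exp z - Phi z)
    (f' := fun z => (Real.sqrt (2 * Real.pi))⁻¹ * Real.exp (1 / 2) * Real.exp z - phiG z)
    (fun z => ((Real.hasDerivAt_exp z).const_mul _).sub (hasDerivAt_Phi z))
    (fun z => sub_nonneg.2 (phiG_le z))
    (by simpa using (Real.tendsto_exp_atBot.const_mul _).sub Phi_tendsto) z
  simpa using this

lemma pow_mul_tendsto (n : ℕ) {f : ℝ → ℝ} {K : ℝ} (h0 : ∀ z, 0 ≤ f z) (h : ∀ z, f z ≤ K * Real.exp z) :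
    Tendsto (fun z => z ^ n * f z) atBot (nhds 0) := by
  have h1 : Tendsto (fun z : ℝ => K * ((-z) ^ n * Real.exp (-(-z)))) atBot (nhds (K * 0)) :=
    ((Real.tendsto_pow_mul_exp_neg_atTop_nhds_zero n).comp tendsto_neg_atBot_atTop).const_mul K
  rw [mul_zero] at h1
  apply squeeze_zero_norm' _ h1
  filter_upwards [eventually_le_atBot (0:ℝ)] with z hz
  rw [norm_mul, norm_pow, Real.norm_eq_abs, Real.norm_eq_abs, abs_of_nonneg (h0 z), abs_of_nonpos hz, neg_neg]
  have : 0 ≤ (-z) ^ n := pow_nonneg (by linarith) n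
  nlinarith [mul_le_mul_of_nonneg_left (h z) this]

lemma ell_nonneg (z : ℝ) : 0 ≤ phiG z + z * Phi z := by
  refine nonneg_of_deriv (f := fun z => phiG z + z * Phi z) (f' := Phi) (fun z => ?_) Phi_nonneg ?_ z
  · refine ((hasDerivAt_phiG z).add ((hasDerivAt_id z).mul (hasDerivAt_Phi z))).congr_deriv ?_
    simp
  · have a := pow_mul_tendsto 0 (fun z => (phiG_pos z).le) phiG_le
    have b := pow_mul_tendsto 1 Phi_nonneg Phi_le
    simpa using a.add b

lemma kay_nonneg (z : ℝ) : 0 ≤ (1 + z ^ 2) * Phi z + z * phiG z := by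
  refine nonneg_of_deriv (f := fun z => (1 + z ^ 2) * Phi z + z * phiG z)
    (f' := fun z => 2 * (phiG z + z * Phi z)) (fun z => ?_) (fun z => by have := ell_nonneg z; positivity) ?_ z
  · refine ((((hasDerivAt_pow 2 z).const_add 1).mul (hasDerivAt_Phi z)).add
      ((hasDerivAt_id z).mul (hasDerivAt_phiG z))).congr_deriv ?_
    simp; ring
  · have a := pow_mul_tendsto 1 (fun z => (phiG_pos z).le) phiG_le
    have b := pow_mul_tendsto 2 Phi_nonneg Phi_le
    have c := pow_mul_tendsto 0 Phi_nonneg Phi_le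
    have := (c.add b).add a
    simp only [add_zero] at this
    refine this.congr fun z => ?_
    ring

lemma mills_mono {q : ℝ} (hq : 0 ≤ q) : Monotone (fun z => (z + q) * (Phi z / phiG z)) := by
  have hd : ∀ z, HasDerivAt (fun z => (z + q) * (Phi z / phiG z))
      (((1 + z ^ 2) * Phi z + z * phiG z + q * (phiG z + z * Phi z)) / phiG z) z := fun z => by
    have hp := (phiG_pos z).ne'
    refine (((hasDerivAt_id z).add_const q).mul ((hasDerivAt_Phi z).div (hasDerivAt_phiG z) hp)).congr_deriv ?_
    simp
    field_simp
    ring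
  refine monotone_of_deriv_nonneg (fun z => (hd z).differentiableAt) (fun z => ?_)
  rw [(hd z).deriv]
  have := ell_nonneg z
  have := kay_nonneg z
  have := phiG_pos z
  positivity

open Classical in
noncomputable def gk (s r : ℝ) : ℝ :=
  if 0 < r then (r⁻¹) ^ s * Real.exp (-(1 / 2) * r⁻¹) else 0

open Classical in
noncomputable def hfun (r : ℝ) : ℝ := if 0 < r then Phi (-(Real.sqrt r)⁻¹) else 0

lemma continuousAt_zero_of {f : ℝ → ℝ} (h0 : ∀ r ≤ 0, f r = 0)
    (h : Tendsto f (nhdsWithin 0 (Set.Ioi 0)) (nhds 0)) : ContinuousAt f 0 := by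
  rw [continuousAt_iff_continuous_left'_right']
  constructor
  · unfold ContinuousWithinAt
    rw [h0 0 le_rfl]
    refine tendsto_const_nhds.congr' ?_
    filter_upwards [self_mem_nhdsWithin] with r hr
    exact (h0 r (le_of_lt hr)).symm
  · unfold ContinuousWithinAt
    rw [h0 0 le_rfl]; exact h

lemma gk_contAt (s : ℝ) : ContinuousAt (gk s) 0 := by
  apply continuousAt_zero_of
  · intro r hr; unfold gk; rw [if_neg (not_lt.2 hr)]
  · refine ((tendsto_rpow_mul_exp_neg_mul_atTop_nhds_zero s (1 / 2) (by norm_num)).comp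
      tendsto_inv_nhdsGT_zero).congr' ?_
    filter_upwards [self_mem_nhdsWithin] with r hr
    unfold gk; rw [if_pos (Set.mem_Ioi.1 hr)]; rfl

lemma gk_deriv (s r : ℝ) : HasDerivAt (gk s) (-s * gk (s + 1) r + 1 / 2 * gk (s + 2) r) r := by
  refine hasDerivAt_of_hasDerivAt_of_ne' (x := 0)
    (g := fun r => -s * gk (s + 1) r + 1 / 2 * gk (s + 2) r) (fun r hr => ?_) (gk_contAt s)
    (((gk_contAt _).const_mul _).add ((gk_contAt _).const_mul _)) r
  rcases lt_or_gt_of_ne hr with h | h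
  · have e : gk s =ᶠ[nhds r] fun _ => 0 := by
      filter_upwards [Iio_mem_nhds h] with t ht
      unfold gk; rw [if_neg (not_lt.2 (le_of_lt ht))]
    have : ∀ s, gk s r = 0 := fun s => by unfold gk; rw [if_neg (not_lt.2 (le_of_lt h))]
    simp only [this, mul_zero, add_zero]
    exact (hasDerivAt_const r (0:ℝ)).congr_of_eventuallyEq e
  · have e : gk s =ᶠ[nhds r] fun r => (r⁻¹) ^ s * Real.exp (-(1 / 2) * r⁻¹) := by
      filter_upwards [Ioi_mem_nhds h] with t ht
      unfold gk; rw [if_pos (Set.mem_Ioi.1 ht)]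
    have : ∀ s, gk s r = (r⁻¹) ^ s * Real.exp (-(1 / 2) * r⁻¹) := fun s => by unfold gk; rw [if_pos h]
    simp only [this]
    refine HasDerivAt.congr_of_eventuallyEq ?_ e
    have hx : 0 < r⁻¹ := inv_pos.2 h
    have hi := hasDerivAt_inv h.ne'
    have h1 := (hi.rpow_const (p := s) (Or.inl hx.ne')).mul ((hi.const_mul (-(1/2:ℝ))).exp)
    refine h1.congr_deriv ?_
    rw [Real.rpow_add hx s 1, Real.rpow_add hx s 2, Real.rpow_sub hx s 1, Real.rpow_one]
    rw [show (2:ℝ) = ((2:ℕ):ℝ) by norm_num, Real.rpow_natCast]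
    push_cast
    field_simp

lemma gk_contDiff (s : ℝ) : ContDiff ℝ 1 (gk s) := by
  have hc : ∀ s, Continuous (gk s) := fun s =>
    continuous_iff_continuousAt.2 fun r => (gk_deriv s r).continuousAt
  rw [contDiff_one_iff_deriv]
  refine ⟨fun r => (gk_deriv s r).differentiableAt, ?_⟩
  rw [show deriv (gk s) = _ from funext fun r => (gk_deriv s r).deriv]
  exact ((hc _).const_mul _).add ((hc _).const_mul _)

lemma hfun_contAt : ContinuousAt hfun 0 := by
  apply continuousAt_zero_of
  · intro r hr; unfold hfun; rw [if_neg (not_lt.2 hr)]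
  · have h1 : Tendsto (fun r : ℝ => Real.sqrt r) (nhdsWithin 0 (Set.Ioi 0)) (nhdsWithin 0 (Set.Ioi 0)) := by
      apply tendsto_nhdsWithin_of_tendsto_nhds_of_eventually_within
      · have : Tendsto (fun r : ℝ => Real.sqrt r) (nhds 0) (nhds 0) := by
          simpa using Real.continuous_sqrt.tendsto 0
        exact this.mono_left nhdsWithin_le_nhds
      · filter_upwards [self_mem_nhdsWithin] with r hr
        exact Real.sqrt_pos.2 hr
    refine (Phi_tendsto.comp (tendsto_neg_atTop_atBot.comp (tendsto_inv_nhdsGT_zero.comp h1))).congr' ?_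
    filter_upwards [self_mem_nhdsWithin] with r hr
    unfold hfun; rw [if_pos (Set.mem_Ioi.1 hr)]; rfl

lemma hfun_deriv (r : ℝ) :
    HasDerivAt hfun ((Real.sqrt (2 * Real.pi))⁻¹ / 2 * gk (3 / 2) r) r := by
  refine hasDerivAt_of_hasDerivAt_of_ne' (x := 0)
    (g := fun r => (Real.sqrt (2 * Real.pi))⁻¹ / 2 * gk (3 / 2) r) (fun r hr => ?_) hfun_contAt
    ((gk_contAt _).const_mul _) r
  rcases lt_or_gt_of_ne hr with h | h
  · have e : hfun =ᶠ[nhds r] fun _ => 0 := by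
      filter_upwards [Iio_mem_nhds h] with t ht
      unfold hfun; rw [if_neg (not_lt.2 (le_of_lt ht))]
    have : ∀ s, gk s r = 0 := fun s => by unfold gk; rw [if_neg (not_lt.2 (le_of_lt h))]
    simp only [this, mul_zero]
    exact (hasDerivAt_const r (0:ℝ)).congr_of_eventuallyEq e
  · have e : hfun =ᶠ[nhds r] fun r => Phi (-(Real.sqrt r)⁻¹) := by
      filter_upwards [Ioi_mem_nhds h] with t ht
      unfold hfun; rw [if_pos (Set.mem_Ioi.1 ht)]
    refine HasDerivAt.congr_of_eventuallyEq ?_ e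
    have hs : 0 < Real.sqrt r := Real.sqrt_pos.2 h
    have h1 := ((Real.hasDerivAt_sqrt h.ne').inv hs.ne').neg
    have h2 := (hasDerivAt_Phi (-(Real.sqrt r)⁻¹)).comp r h1
    refine h2.congr_deriv ?_
    have hx : 0 < r⁻¹ := inv_pos.2 h
    unfold gk phiG
    rw [if_pos h, show (3 / 2 : ℝ) = 1 + 1 / 2 by norm_num, Real.rpow_add hx, Real.rpow_one,
      ← Real.sqrt_eq_rpow, Real.sqrt_inv, neg_sq, inv_pow, Real.sq_sqrt h.le]
    rw [show -r⁻¹ / 2 = -(1 / 2) * r⁻¹ by ring]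
    field_simp

lemma hfun_contDiff : ContDiff ℝ 2 hfun := by
  have hd : deriv hfun = _ := funext fun z => (hfun_deriv z).deriv
  have : ContDiff ℝ (1 + 1) hfun := by
    rw [contDiff_succ_iff_deriv]
    refine ⟨fun z => (hfun_deriv z).differentiableAt, by simp, ?_⟩
    rw [hd]; exact contDiff_const.mul (gk_contDiff _)
  exact this.of_le (by norm_num)

lemma hfun_nonpos {r : ℝ} (h : r ≤ 0) : hfun r = 0 := by
  unfold hfun; rw [if_neg (not_lt.2 h)]

/-- `Φ(n/√d)` for negative `n`. -/
lemma Phi_eq_hfun {n d : ℝ} (hn : n < 0) (hd : 0 < d) : Phi (n / Real.sqrt d) = hfun (d / n ^ 2) := by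
  have hn2 : 0 < n ^ 2 := by nlinarith
  unfold hfun
  rw [if_pos (div_pos hd hn2), Real.sqrt_div hd.le, Real.sqrt_sq_eq_abs, abs_of_neg hn]
  congr 1
  have := Real.sqrt_pos.2 hd
  rw [inv_div, neg_div, neg_neg]

noncomputable def Dq (μ δ σ₁ σ₂ x y : ℝ) : ℝ := σ₂ * (σ₁ * y - σ₂ * x) * (μ + δ * (σ₁ + σ₂))

noncomputable def Ef (μ δ σ₁ σ₂ α β p q x y : ℝ) : ℝ :=
  Real.exp (-(α * x + β * y)) * Phi ((p * x + q * y) / Real.sqrt (Dq μ δ σ₁ σ₂ x y))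

noncomputable def p1 (δ σ₂ : ℝ) : ℝ := δ * σ₂
noncomputable def q1 (μ δ σ₂ : ℝ) : ℝ := μ + δ * σ₂
noncomputable def p2 (μ δ σ₁ σ₂ : ℝ) : ℝ := (2 * μ + δ * (σ₁ + σ₂)) * σ₂ / (σ₁ + σ₂)
noncomputable def q2 (μ δ σ₁ σ₂ : ℝ) : ℝ := ((μ + δ * σ₂) * (σ₁ + σ₂) - 2 * μ * σ₁) / (σ₁ + σ₂)
noncomputable def p3 (μ δ σ₁ σ₂ : ℝ) : ℝ := -((2 * μ + δ * (σ₁ + σ₂) + δ * σ₂) * (σ₂ / σ₁))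
noncomputable def p4 (μ δ σ₁ σ₂ : ℝ) : ℝ :=
  -((δ * σ₁ ^ 2 + 3 * δ * σ₁ * σ₂ + 2 * (μ + δ * σ₂) * σ₂) * (σ₂ / σ₁)) / (σ₁ + σ₂)
noncomputable def al2 (μ σ₁ σ₂ : ℝ) : ℝ := 2 * μ / (σ₁ + σ₂) ^ 2
noncomputable def al3 (μ δ σ₁ σ₂ : ℝ) : ℝ := 2 * (μ + δ * σ₂) / σ₁ ^ 2
noncomputable def al4 (μ δ σ₁ σ₂ : ℝ) : ℝ := 2 * σ₂ / σ₁ ^ 2 * (μ * σ₂ / (σ₁ + σ₂) ^ 2 + δ)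

noncomputable def E1 (μ δ σ₁ σ₂ x y : ℝ) : ℝ := Ef μ δ σ₁ σ₂ 0 0 (p1 δ σ₂) (q1 μ δ σ₂) x y
noncomputable def E2 (μ δ σ₁ σ₂ x y : ℝ) : ℝ :=
  Ef μ δ σ₁ σ₂ (al2 μ σ₁ σ₂) (al2 μ σ₁ σ₂) (p2 μ δ σ₁ σ₂) (q2 μ δ σ₁ σ₂) x y
noncomputable def E3 (μ δ σ₁ σ₂ x y : ℝ) : ℝ :=
  Ef μ δ σ₁ σ₂ (al3 μ δ σ₁ σ₂) 0 (p3 μ δ σ₁ σ₂) (q1 μ δ σ₂) x y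
noncomputable def E4 (μ δ σ₁ σ₂ x y : ℝ) : ℝ :=
  Ef μ δ σ₁ σ₂ (al4 μ δ σ₁ σ₂) (al2 μ σ₁ σ₂) (p4 μ δ σ₁ σ₂) (q2 μ δ σ₁ σ₂) x y

lemma VformE_eq (μ δ σ₁ σ₂ x y : ℝ) : VformE μ δ σ₁ σ₂ x y =
    E1 μ δ σ₁ σ₂ x y - E2 μ δ σ₁ σ₂ x y - E3 μ δ σ₁ σ₂ x y + E4 μ δ σ₁ σ₂ x y := by
  unfold VformE E1 E2 E3 E4 Ef
  rw [← Dq]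
  simp only [← div_div _ (σ₁ + σ₂) _]
  have e1 : Real.exp (-(0 * x + 0 * y)) = 1 := by simp
  rw [e1, one_mul]
  have a2 : -(2 * μ * (x + y)) / (σ₁ + σ₂) ^ 2 = -(al2 μ σ₁ σ₂ * x + al2 μ σ₁ σ₂ * y) := by
    unfold al2; ring
  have a3 : -(2 * (μ + δ * σ₂) * x) / σ₁ ^ 2 = -(al3 μ δ σ₁ σ₂ * x + 0 * y) := by
    unfold al3; ring
  have a4 : -(2 * μ * y) / (σ₁ + σ₂) ^ 2 - 2 * σ₂ * x / σ₁ ^ 2 * (μ * σ₂ / (σ₁ + σ₂) ^ 2 + δ)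
      = -(al4 μ δ σ₁ σ₂ * x + al2 μ σ₁ σ₂ * y) := by
    unfold al4 al2; ring
  have b2 : ((2 * μ + δ * (σ₁ + σ₂)) * σ₂ * x + ((μ + δ * σ₂) * (σ₁ + σ₂) - 2 * μ * σ₁) * y) / (σ₁ + σ₂)
      = p2 μ δ σ₁ σ₂ * x + q2 μ δ σ₁ σ₂ * y := by
    unfold p2 q2; ring
  have b3 : (μ + δ * σ₂) * y - (2 * μ + δ * (σ₁ + σ₂) + δ * σ₂) * (σ₂ / σ₁) * x
      = p3 μ δ σ₁ σ₂ * x + q1 μ δ σ₂ * y := by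
    unfold p3 q1; ring
  have b4 : (((μ + δ * σ₂) * (σ₁ + σ₂) - 2 * μ * σ₁) * y
            - (δ * σ₁ ^ 2 + 3 * δ * σ₁ * σ₂ + 2 * (μ + δ * σ₂) * σ₂) * (σ₂ / σ₁) * x) / (σ₁ + σ₂)
      = p4 μ δ σ₁ σ₂ * x + q2 μ δ σ₁ σ₂ * y := by
    unfold p4 q2; ring
  rw [a2, a3, a4, b2, b3, b4]
  rfl

/-- The common Gaussian factor. -/
noncomputable def gg (μ δ σ₁ σ₂ x y : ℝ) : ℝ :=
  phiG ((p1 δ σ₂ * x + q1 μ δ σ₂ * y) / Real.sqrt (Dq μ δ σ₁ σ₂ x y))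

lemma gauss_gen {N a b e : ℝ} (hN : N ≠ 0) (h : b ^ 2 - a ^ 2 = 2 * N ^ 2 * e) :
    Real.exp (-e) * phiG (a / N) = phiG (b / N) := by
  unfold phiG
  rw [mul_left_comm, ← Real.exp_add]
  congr 2
  field_simp
  linarith

section
variable {μ δ σ₁ σ₂ : ℝ}

lemma gauss2 (h1 : 0 < σ₁) (h2 : 0 < σ₂) {x y : ℝ} (hD : 0 < Dq μ δ σ₁ σ₂ x y) :
    Real.exp (-(al2 μ σ₁ σ₂ * x + al2 μ σ₁ σ₂ * y)) *
      phiG ((p2 μ δ σ₁ σ₂ * x + q2 μ δ σ₁ σ₂ * y) / Real.sqrt (Dq μ δ σ₁ σ₂ x y)) = gg μ δ σ₁ σ₂ x y := by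
  have hs : σ₁ + σ₂ ≠ 0 := by positivity
  apply gauss_gen (Real.sqrt_pos.2 hD).ne'
  rw [Real.sq_sqrt hD.le]
  unfold Dq p2 q2 p1 q1 al2
  field_simp
  ring

lemma gauss3 (h1 : 0 < σ₁) (h2 : 0 < σ₂) {x y : ℝ} (hD : 0 < Dq μ δ σ₁ σ₂ x y) :
    Real.exp (-(al3 μ δ σ₁ σ₂ * x + 0 * y)) *
      phiG ((p3 μ δ σ₁ σ₂ * x + q1 μ δ σ₂ * y) / Real.sqrt (Dq μ δ σ₁ σ₂ x y)) = gg μ δ σ₁ σ₂ x y := by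
  have hs : σ₁ + σ₂ ≠ 0 := by positivity
  apply gauss_gen (Real.sqrt_pos.2 hD).ne'
  rw [Real.sq_sqrt hD.le]
  unfold Dq p3 p1 q1 al3
  field_simp
  ring

lemma gauss4 (h1 : 0 < σ₁) (h2 : 0 < σ₂) {x y : ℝ} (hD : 0 < Dq μ δ σ₁ σ₂ x y) :
    Real.exp (-(al4 μ δ σ₁ σ₂ * x + al2 μ σ₁ σ₂ * y)) *
      phiG ((p4 μ δ σ₁ σ₂ * x + q2 μ δ σ₁ σ₂ * y) / Real.sqrt (Dq μ δ σ₁ σ₂ x y)) = gg μ δ σ₁ σ₂ x y := by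
  have hs : σ₁ + σ₂ ≠ 0 := by positivity
  apply gauss_gen (Real.sqrt_pos.2 hD).ne'
  rw [Real.sq_sqrt hD.le]
  unfold Dq p4 q2 p1 q1 al2 al4
  field_simp
  ring

/-- Derivative of `(p x + q y)/√Dq` in direction `(u, v)`. -/
noncomputable def dZ (μ δ σ₁ σ₂ p q x y u v : ℝ) : ℝ :=
  (p * u + q * v) / Real.sqrt (Dq μ δ σ₁ σ₂ x y)
    - (p * x + q * y) * Dq μ δ σ₁ σ₂ u v / (2 * Real.sqrt (Dq μ δ σ₁ σ₂ x y) ^ 3)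

lemma Ef_deriv {α β p q u v : ℝ} {X Y : ℝ → ℝ} {t : ℝ} (hD : 0 < Dq μ δ σ₁ σ₂ (X t) (Y t))
    (hX : HasDerivAt X u t) (hY : HasDerivAt Y v t) {g : ℝ}
    (hg : Real.exp (-(α * X t + β * Y t)) * phiG ((p * X t + q * Y t) / Real.sqrt (Dq μ δ σ₁ σ₂ (X t) (Y t))) = g) :
    HasDerivAt (fun t => Ef μ δ σ₁ σ₂ α β p q (X t) (Y t))
      (-(α * u + β * v) * Ef μ δ σ₁ σ₂ α β p q (X t) (Y t) + g * dZ μ δ σ₁ σ₂ p q (X t) (Y t) u v) t := by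
  have hs : 0 < Real.sqrt (Dq μ δ σ₁ σ₂ (X t) (Y t)) := Real.sqrt_pos.2 hD
  have hDq : HasDerivAt (fun t => Dq μ δ σ₁ σ₂ (X t) (Y t)) (Dq μ δ σ₁ σ₂ u v) t := by
    unfold Dq
    exact (((hY.const_mul σ₁).sub (hX.const_mul σ₂)).const_mul σ₂).mul_const _
  have hZ : HasDerivAt (fun t => (p * X t + q * Y t) / Real.sqrt (Dq μ δ σ₁ σ₂ (X t) (Y t)))
      (dZ μ δ σ₁ σ₂ p q (X t) (Y t) u v) t := by
    refine (((hX.const_mul p).add (hY.const_mul q)).div (hDq.sqrt hD.ne') hs.ne').congr_deriv ?_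
    unfold dZ
    simp only [Pi.add_apply]
    field_simp
  have he : HasDerivAt (fun t => Real.exp (-(α * X t + β * Y t)))
      (Real.exp (-(α * X t + β * Y t)) * (-(α * u + β * v))) t :=
    ((hX.const_mul α).add (hY.const_mul β)).neg.exp
  have hP := (hasDerivAt_Phi ((p * X t + q * Y t) / Real.sqrt (Dq μ δ σ₁ σ₂ (X t) (Y t)))).comp t hZ
  refine (he.mul hP).congr_deriv ?_
  rw [← hg]
  unfold Ef
  simp only [Function.comp]
  ring

lemma E1_d (_ : 0 < σ₁) (_ : 0 < σ₂) {X Y : ℝ → ℝ} {t u v : ℝ} (hD : 0 < Dq μ δ σ₁ σ₂ (X t) (Y t))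
    (hX : HasDerivAt X u t) (hY : HasDerivAt Y v t) :
    HasDerivAt (fun t => E1 μ δ σ₁ σ₂ (X t) (Y t))
      (gg μ δ σ₁ σ₂ (X t) (Y t) * dZ μ δ σ₁ σ₂ (p1 δ σ₂) (q1 μ δ σ₂) (X t) (Y t) u v) t := by
  refine (Ef_deriv hD hX hY (α := 0) (β := 0) (g := gg μ δ σ₁ σ₂ (X t) (Y t)) ?_).congr_deriv ?_
  · unfold gg; simp
  · simp

lemma E2_d (h1 : 0 < σ₁) (h2 : 0 < σ₂) {X Y : ℝ → ℝ} {t u v : ℝ} (hD : 0 < Dq μ δ σ₁ σ₂ (X t) (Y t))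
    (hX : HasDerivAt X u t) (hY : HasDerivAt Y v t) :
    HasDerivAt (fun t => E2 μ δ σ₁ σ₂ (X t) (Y t))
      (-(al2 μ σ₁ σ₂ * u + al2 μ σ₁ σ₂ * v) * E2 μ δ σ₁ σ₂ (X t) (Y t) +
      gg μ δ σ₁ σ₂ (X t) (Y t) * dZ μ δ σ₁ σ₂ (p2 μ δ σ₁ σ₂) (q2 μ δ σ₁ σ₂) (X t) (Y t) u v) t :=
  Ef_deriv hD hX hY (gauss2 h1 h2 hD)

lemma E3_d (h1 : 0 < σ₁) (h2 : 0 < σ₂) {X Y : ℝ → ℝ} {t u v : ℝ} (hD : 0 < Dq μ δ σ₁ σ₂ (X t) (Y t))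
    (hX : HasDerivAt X u t) (hY : HasDerivAt Y v t) :
    HasDerivAt (fun t => E3 μ δ σ₁ σ₂ (X t) (Y t))
      (-(al3 μ δ σ₁ σ₂ * u + 0 * v) * E3 μ δ σ₁ σ₂ (X t) (Y t) +
      gg μ δ σ₁ σ₂ (X t) (Y t) * dZ μ δ σ₁ σ₂ (p3 μ δ σ₁ σ₂) (q1 μ δ σ₂) (X t) (Y t) u v) t :=
  Ef_deriv hD hX hY (gauss3 h1 h2 hD)

lemma E4_d (h1 : 0 < σ₁) (h2 : 0 < σ₂) {X Y : ℝ → ℝ} {t u v : ℝ} (hD : 0 < Dq μ δ σ₁ σ₂ (X t) (Y t))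
    (hX : HasDerivAt X u t) (hY : HasDerivAt Y v t) :
    HasDerivAt (fun t => E4 μ δ σ₁ σ₂ (X t) (Y t))
      (-(al4 μ δ σ₁ σ₂ * u + al2 μ σ₁ σ₂ * v) * E4 μ δ σ₁ σ₂ (X t) (Y t) +
      gg μ δ σ₁ σ₂ (X t) (Y t) * dZ μ δ σ₁ σ₂ (p4 μ δ σ₁ σ₂) (q2 μ δ σ₁ σ₂) (X t) (Y t) u v) t :=
  Ef_deriv hD hX hY (gauss4 h1 h2 hD)

lemma p_rel (h1 : 0 < σ₁) (h2 : 0 < σ₂) :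
    p1 δ σ₂ - p2 μ δ σ₁ σ₂ - p3 μ δ σ₁ σ₂ + p4 μ δ σ₁ σ₂ = 0 := by
  have hs : σ₁ + σ₂ ≠ 0 := by positivity
  unfold p1 p2 p3 p4
  field_simp
  ring

lemma dZ_rel (h1 : 0 < σ₁) (h2 : 0 < σ₂) (x y u v : ℝ) :
    dZ μ δ σ₁ σ₂ (p1 δ σ₂) (q1 μ δ σ₂) x y u v - dZ μ δ σ₁ σ₂ (p2 μ δ σ₁ σ₂) (q2 μ δ σ₁ σ₂) x y u v
    - dZ μ δ σ₁ σ₂ (p3 μ δ σ₁ σ₂) (q1 μ δ σ₂) x y u v + dZ μ δ σ₁ σ₂ (p4 μ δ σ₁ σ₂) (q2 μ δ σ₁ σ₂) x y u v = 0 := by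
  have h := p_rel (μ := μ) (δ := δ) h1 h2
  have : p4 μ δ σ₁ σ₂ = - p1 δ σ₂ + p2 μ δ σ₁ σ₂ + p3 μ δ σ₁ σ₂ := by linarith
  rw [this]
  unfold dZ
  ring

lemma Vform_d (h1 : 0 < σ₁) (h2 : 0 < σ₂) {X Y : ℝ → ℝ} {t u v : ℝ} (hD : 0 < Dq μ δ σ₁ σ₂ (X t) (Y t))
    (hX : HasDerivAt X u t) (hY : HasDerivAt Y v t) :
    HasDerivAt (fun t => VformE μ δ σ₁ σ₂ (X t) (Y t))
      ((al2 μ σ₁ σ₂ * u + al2 μ σ₁ σ₂ * v) * E2 μ δ σ₁ σ₂ (X t) (Y t)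
      + (al3 μ δ σ₁ σ₂ * u) * E3 μ δ σ₁ σ₂ (X t) (Y t)
      - (al4 μ δ σ₁ σ₂ * u + al2 μ σ₁ σ₂ * v) * E4 μ δ σ₁ σ₂ (X t) (Y t)) t := by
  simp only [VformE_eq]
  refine ((((E1_d h1 h2 hD hX hY).sub (E2_d h1 h2 hD hX hY)).sub (E3_d h1 h2 hD hX hY)).add
    (E4_d h1 h2 hD hX hY)).congr_deriv ?_
  linear_combination gg μ δ σ₁ σ₂ (X t) (Y t) * dZ_rel (μ := μ) (δ := δ) h1 h2 (X t) (Y t) u v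

/-- The pde, algebraically. -/
lemma pde_alg (h1 : 0 < σ₁) (h2 : 0 < σ₂) {x y : ℝ} (hD : 0 < Dq μ δ σ₁ σ₂ x y) (e2 e3 e4 g : ℝ) :
    σ₁ ^ 2 / 2 * (al2 μ σ₁ σ₂ * (-al2 μ σ₁ σ₂ * e2 + g * dZ μ δ σ₁ σ₂ (p2 μ δ σ₁ σ₂) (q2 μ δ σ₁ σ₂) x y 1 0)
      + al3 μ δ σ₁ σ₂ * (-al3 μ δ σ₁ σ₂ * e3 + g * dZ μ δ σ₁ σ₂ (p3 μ δ σ₁ σ₂) (q1 μ δ σ₂) x y 1 0)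
      - al4 μ δ σ₁ σ₂ * (-al4 μ δ σ₁ σ₂ * e4 + g * dZ μ δ σ₁ σ₂ (p4 μ δ σ₁ σ₂) (q2 μ δ σ₁ σ₂) x y 1 0))
    + σ₂ ^ 2 / 2 * (al2 μ σ₁ σ₂ * (-al2 μ σ₁ σ₂ * e2 + g * dZ μ δ σ₁ σ₂ (p2 μ δ σ₁ σ₂) (q2 μ δ σ₁ σ₂) x y 0 1)
      - al2 μ σ₁ σ₂ * (-al2 μ σ₁ σ₂ * e4 + g * dZ μ δ σ₁ σ₂ (p4 μ δ σ₁ σ₂) (q2 μ δ σ₁ σ₂) x y 0 1))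
    + σ₁ * σ₂ * (al2 μ σ₁ σ₂ * (-al2 μ σ₁ σ₂ * e2 + g * dZ μ δ σ₁ σ₂ (p2 μ δ σ₁ σ₂) (q2 μ δ σ₁ σ₂) x y 0 1)
      + al3 μ δ σ₁ σ₂ * (g * dZ μ δ σ₁ σ₂ (p3 μ δ σ₁ σ₂) (q1 μ δ σ₂) x y 0 1)
      - al4 μ δ σ₁ σ₂ * (-al2 μ σ₁ σ₂ * e4 + g * dZ μ δ σ₁ σ₂ (p4 μ δ σ₁ σ₂) (q2 μ δ σ₁ σ₂) x y 0 1))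
    + ((μ + δ * σ₂) * (al2 μ σ₁ σ₂ * e2 + al3 μ δ σ₁ σ₂ * e3 - al4 μ δ σ₁ σ₂ * e4)
      + (μ - (μ + δ * σ₂)) * (al2 μ σ₁ σ₂ * e2 - al2 μ σ₁ σ₂ * e4)) = 0 := by
  have hs : σ₁ + σ₂ ≠ 0 := by positivity
  unfold dZ
  generalize hN : Real.sqrt (Dq μ δ σ₁ σ₂ x y) = N
  have hN0 : N ≠ 0 := by rw [← hN]; exact (Real.sqrt_pos.2 hD).ne'
  have hN2 : N ^ 2 = Dq μ δ σ₁ σ₂ x y := by rw [← hN]; exact Real.sq_sqrt hD.le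
  unfold Dq at hN2
  unfold Dq p2 p3 p4 q1 q2 al2 al3 al4
  field_simp
  linear_combination 4 * g * μ * σ₁ ^ 2 * σ₂ ^ 2 * (σ₁ + σ₂) ^ 2 * (μ + δ * (σ₁ + σ₂)) * hN2

/-- Key inequality. -/
lemma key_ineq (hμ : 0 < μ) (h1 : 0 < σ₁) (h2 : 0 < σ₂) (hk : 0 < μ + δ * (σ₁ + σ₂)) {x y : ℝ} (hx : 0 ≤ x)
    (hD : 0 < Dq μ δ σ₁ σ₂ x y) :
    (al4 μ δ σ₁ σ₂ - al2 μ σ₁ σ₂) * E4 μ δ σ₁ σ₂ x y ≤ al3 μ δ σ₁ σ₂ * E3 μ δ σ₁ σ₂ x y := by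
  have hs : 0 < σ₁ + σ₂ := by positivity
  have g3 := gauss3 h1 h2 hD
  have g4 := gauss4 h1 h2 hD
  have hN : 0 < Real.sqrt (Dq μ δ σ₁ σ₂ x y) := Real.sqrt_pos.2 hD
  have hN2 := Real.sq_sqrt hD.le
  unfold E3 E4 Ef
  set N := Real.sqrt (Dq μ δ σ₁ σ₂ x y) with hNdef
  set z3 := (p3 μ δ σ₁ σ₂ * x + q1 μ δ σ₂ * y) / N with hz3
  set z4 := (p4 μ δ σ₁ σ₂ * x + q2 μ δ σ₁ σ₂ * y) / N with hz4
  have hg := phiG_pos ((p1 δ σ₂ * x + q1 μ δ σ₂ * y) / N)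
  have hgg : gg μ δ σ₁ σ₂ x y = phiG ((p1 δ σ₂ * x + q1 μ δ σ₂ * y) / N) := rfl
  rw [← hgg] at hg
  set g := gg μ δ σ₁ σ₂ x y
  have r3 : Real.exp (-(al3 μ δ σ₁ σ₂ * x + 0 * y)) * Phi z3 = g * (Phi z3 / phiG z3) := by
    rw [← g3]; have := (phiG_pos z3).ne'; field_simp
  have r4 : Real.exp (-(al4 μ δ σ₁ σ₂ * x + al2 μ σ₁ σ₂ * y)) * Phi z4 = g * (Phi z4 / phiG z4) := by
    rw [← g4]; have := (phiG_pos z4).ne'; field_simp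
  rw [r3, r4]
  set k := σ₂ * (μ + δ * (σ₁ + σ₂)) with hkdef
  have hk0 : 0 < k := by positivity
  set q := x * k / (σ₁ * N) with hq
  have hq0 : 0 ≤ q := by positivity
  have c3 : al3 μ δ σ₁ σ₂ = 2 * k / (σ₁ * N) * (z3 + q) := by
    have : al3 μ δ σ₁ σ₂ * N ^ 2 = 2 * k / σ₁ * ((p3 μ δ σ₁ σ₂ * x + q1 μ δ σ₂ * y) + x * k / σ₁) := by
      rw [hN2, hkdef]; unfold Dq p3 q1 al3; field_simp; ring
    rw [hz3, hq]
    field_simp at this ⊢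
    linarith
  have c4 : al4 μ δ σ₁ σ₂ - al2 μ σ₁ σ₂ = 2 * k / (σ₁ * N) * (z4 + q) := by
    have : (al4 μ δ σ₁ σ₂ - al2 μ σ₁ σ₂) * N ^ 2 = 2 * k / σ₁ * ((p4 μ δ σ₁ σ₂ * x + q2 μ δ σ₁ σ₂ * y) + x * k / σ₁) := by
      rw [hN2, hkdef]; unfold Dq p4 q2 al4 al2; field_simp; ring
    rw [hz4, hq]
    field_simp at this ⊢
    linarith
  have hc0 : 0 < 2 * k / (σ₁ * N) := by positivity
  have hzz : z4 ≤ z3 := by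
    have : al4 μ δ σ₁ σ₂ - al2 μ σ₁ σ₂ ≤ al3 μ δ σ₁ σ₂ := by
      have : al3 μ δ σ₁ σ₂ - (al4 μ δ σ₁ σ₂ - al2 μ σ₁ σ₂) = 4 * μ / (σ₁ * (σ₁ + σ₂)) := by
        unfold al3 al4 al2; field_simp; ring
      have : 0 ≤ 4 * μ / (σ₁ * (σ₁ + σ₂)) := by positivity
      linarith
    rw [c3, c4] at this
    have := le_of_mul_le_mul_left this hc0
    linarith
  have hm := mills_mono hq0 hzz
  simp only at hm
  rw [c3, c4]
  calc _ = 2 * k / (σ₁ * N) * g * ((z4 + q) * (Phi z4 / phiG z4)) := by ring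
    _ ≤ 2 * k / (σ₁ * N) * g * ((z3 + q) * (Phi z3 / phiG z3)) := by gcongr
    _ = _ := by ring

end

section
variable {μ δ σ₁ σ₂ : ℝ}

lemma Dq_pos_iff (h1 : 0 < σ₁) (h2 : 0 < σ₂) (hk : 0 < μ + δ * (σ₁ + σ₂)) {x y : ℝ} :
    0 < Dq μ δ σ₁ σ₂ x y ↔ σ₂ / σ₁ * x < y := by
  unfold Dq
  rw [mul_pos_iff_of_pos_right hk, mul_pos_iff_of_pos_left h2, sub_pos, div_mul_eq_mul_div, div_lt_iff₀ h1,
    mul_comm y]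

lemma Dq_swap_pos_iff (h1 : 0 < σ₁) (h2 : 0 < σ₂) (hk : 0 < μ + δ * (σ₁ + σ₂)) {x y : ℝ} :
    0 < Dq μ δ σ₂ σ₁ y x ↔ y < σ₂ / σ₁ * x := by
  rw [Dq_pos_iff h2 h1 (by rwa [add_comm σ₂]), div_mul_eq_mul_div, div_mul_eq_mul_div, div_lt_iff₀ h2,
    lt_div_iff₀ h1, mul_comm x, mul_comm y]

lemma Vext_up (h1 : 0 < σ₁) (h2 : 0 < σ₂) (hk : 0 < μ + δ * (σ₁ + σ₂)) {x y : ℝ}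
    (hD : 0 < Dq μ δ σ₁ σ₂ x y) : Vext μ δ σ₁ σ₂ x y = VformE μ δ σ₁ σ₂ x y := by
  unfold Vext; rw [if_pos ((Dq_pos_iff h1 h2 hk).1 hD)]

lemma Vext_down (h1 : 0 < σ₁) (h2 : 0 < σ₂) (hk : 0 < μ + δ * (σ₁ + σ₂)) {x y : ℝ}
    (hD : 0 < Dq μ δ σ₂ σ₁ y x) : Vext μ δ σ₁ σ₂ x y = VformE μ δ σ₂ σ₁ y x := by
  have := (Dq_swap_pos_iff h1 h2 hk).1 hD
  unfold Vext; rw [if_neg (not_lt.2 this.le), if_pos this]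

lemma Vext_diag (x : ℝ) (h1 : 0 < σ₁) (h2 : 0 < σ₂) :
    Vext μ δ σ₁ σ₂ x (σ₂ / σ₁ * x) = 1 - Real.exp (-(al2 μ σ₁ σ₂ * x + al2 μ σ₁ σ₂ * (σ₂ / σ₁ * x))) := by
  unfold Vext; rw [if_neg (lt_irrefl _), if_neg (lt_irrefl _)]
  congr 2
  unfold al2
  have : σ₁ + σ₂ ≠ 0 := by positivity
  field_simp

lemma Vext_swap (h1 : 0 < σ₁) (h2 : 0 < σ₂) (hk : 0 < μ + δ * (σ₁ + σ₂)) (x y : ℝ) :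
    Vext μ δ σ₁ σ₂ x y = Vext μ δ σ₂ σ₁ y x := by
  have hk' : 0 < μ + δ * (σ₂ + σ₁) := by rwa [add_comm σ₂]
  rcases lt_trichotomy (σ₂ / σ₁ * x) y with h | h | h
  · have := (Dq_pos_iff h1 h2 hk).2 h
    rw [Vext_up h1 h2 hk this, Vext_down h2 h1 hk' this]
  · have e : x = σ₁ / σ₂ * y := by rw [← h]; field_simp
    have A := Vext_diag (μ := μ) (δ := δ) x h1 h2
    have B := Vext_diag (μ := μ) (δ := δ) y h2 h1
    rw [h] at A
    rw [← e] at B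
    rw [A, B]
    congr 2
    unfold al2
    ring
  · have := (Dq_swap_pos_iff h1 h2 hk).2 h
    rw [Vext_up h2 h1 hk' this, Vext_down h1 h2 hk this]

lemma Dq_contDiff (n : WithTop ℕ∞) : ContDiff ℝ n (fun p : ℝ × ℝ => Dq μ δ σ₁ σ₂ p.1 p.2) := by
  unfold Dq; fun_prop

lemma Ef_contDiffAt {α β p q : ℝ} {w : ℝ × ℝ} (hD : 0 < Dq μ δ σ₁ σ₂ w.1 w.2) :
    ContDiffAt ℝ 2 (fun w : ℝ × ℝ => Ef μ δ σ₁ σ₂ α β p q w.1 w.2) w := by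
  unfold Ef
  refine ContDiffAt.mul (by fun_prop) ?_
  refine Phi_contDiff.contDiffAt.comp w ?_
  refine ContDiffAt.div (by fun_prop) ((Dq_contDiff 2).contDiffAt.sqrt hD.ne') (Real.sqrt_pos.2 hD).ne'

lemma Vform_contDiffAt {w : ℝ × ℝ} (hD : 0 < Dq μ δ σ₁ σ₂ w.1 w.2) :
    ContDiffAt ℝ 2 (fun w : ℝ × ℝ => VformE μ δ σ₁ σ₂ w.1 w.2) w := by
  simp only [VformE_eq]
  exact (((Ef_contDiffAt hD).sub (Ef_contDiffAt hD)).sub (Ef_contDiffAt hD)).add (Ef_contDiffAt hD)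

noncomputable def Hf (μ δ σ₁ σ₂ α β p q x y : ℝ) : ℝ :=
  Real.exp (-(α * x + β * y)) * hfun (Dq μ δ σ₁ σ₂ x y / (p * x + q * y) ^ 2)

lemma Hf_contDiffAt {α β p q : ℝ} {w : ℝ × ℝ} (hn : p * w.1 + q * w.2 ≠ 0) :
    ContDiffAt ℝ 2 (fun w : ℝ × ℝ => Hf μ δ σ₁ σ₂ α β p q w.1 w.2) w := by
  unfold Hf
  refine ContDiffAt.mul (by fun_prop) ?_
  refine hfun_contDiff.contDiffAt.comp w ?_
  exact ContDiffAt.div (Dq_contDiff 2).contDiffAt (by fun_prop) (pow_ne_zero 2 hn)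

lemma Hf_zero {α β p q x y : ℝ} (hD : Dq μ δ σ₁ σ₂ x y ≤ 0) : Hf μ δ σ₁ σ₂ α β p q x y = 0 := by
  unfold Hf
  rw [hfun_nonpos (div_nonpos_of_nonpos_of_nonneg hD (sq_nonneg _)), mul_zero]

lemma Ef_neg {α β p q x y : ℝ} (hD : 0 < Dq μ δ σ₁ σ₂ x y) (hn : p * x + q * y < 0) :
    Ef μ δ σ₁ σ₂ α β p q x y = Hf μ δ σ₁ σ₂ α β p q x y := by
  unfold Ef Hf; rw [Phi_eq_hfun hn hD]

lemma Ef_pos {α β p q x y : ℝ} (hD : 0 < Dq μ δ σ₁ σ₂ x y) (hn : 0 < p * x + q * y) :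
    Ef μ δ σ₁ σ₂ α β p q x y = Real.exp (-(α * x + β * y)) - Hf μ δ σ₁ σ₂ α β p q x y := by
  unfold Ef Hf
  have := Phi_eq_hfun (n := -(p * x + q * y)) (by linarith) hD
  rw [neg_div, Phi_neg, neg_sq] at this
  rw [← this]; ring

noncomputable def Rup (μ δ σ₁ σ₂ x y : ℝ) : ℝ :=
  -Hf μ δ σ₁ σ₂ 0 0 (p1 δ σ₂) (q1 μ δ σ₂) x y
  + Hf μ δ σ₁ σ₂ (al2 μ σ₁ σ₂) (al2 μ σ₁ σ₂) (p2 μ δ σ₁ σ₂) (q2 μ δ σ₁ σ₂) x y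
  - Hf μ δ σ₁ σ₂ (al3 μ δ σ₁ σ₂) 0 (p3 μ δ σ₁ σ₂) (q1 μ δ σ₂) x y
  + Hf μ δ σ₁ σ₂ (al4 μ δ σ₁ σ₂) (al2 μ σ₁ σ₂) (p4 μ δ σ₁ σ₂) (q2 μ δ σ₁ σ₂) x y

lemma Rup_zero {x y : ℝ} (hD : Dq μ δ σ₁ σ₂ x y ≤ 0) : Rup μ δ σ₁ σ₂ x y = 0 := by
  unfold Rup; rw [Hf_zero hD, Hf_zero hD, Hf_zero hD, Hf_zero hD]; ring

def Good (μ δ σ₁ σ₂ x y : ℝ) : Prop :=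
  0 < p1 δ σ₂ * x + q1 μ δ σ₂ * y ∧ 0 < p2 μ δ σ₁ σ₂ * x + q2 μ δ σ₁ σ₂ * y ∧
  p3 μ δ σ₁ σ₂ * x + q1 μ δ σ₂ * y < 0 ∧ p4 μ δ σ₁ σ₂ * x + q2 μ δ σ₁ σ₂ * y < 0

lemma good_open {w : ℝ × ℝ} (h : Good μ δ σ₁ σ₂ w.1 w.2) : ∀ᶠ w' in nhds w, Good μ δ σ₁ σ₂ w'.1 w'.2 := by
  obtain ⟨a, b, c, d⟩ := h
  have hc : ∀ p q : ℝ, Continuous (fun w : ℝ × ℝ => p * w.1 + q * w.2) := fun p q => by fun_prop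
  filter_upwards [(hc _ _).continuousAt.eventually (lt_mem_nhds a), (hc _ _).continuousAt.eventually (lt_mem_nhds b),
    (hc _ _).continuousAt.eventually (gt_mem_nhds c), (hc _ _).continuousAt.eventually (gt_mem_nhds d)]
    with w' a b c d using ⟨a, b, c, d⟩

lemma good_diag (h1 : 0 < σ₁) (h2 : 0 < σ₂) (hk : 0 < μ + δ * (σ₁ + σ₂)) {x y : ℝ} (hx : 0 < x)
    (h : σ₂ / σ₁ * x = y) : Good μ δ σ₁ σ₂ x y := by
  have hs : σ₁ + σ₂ ≠ 0 := by positivity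
  have hp : 0 < σ₂ * (μ + δ * (σ₁ + σ₂)) * x / σ₁ := by positivity
  subst h
  refine ⟨?_, ?_, ?_, ?_⟩
  · convert hp using 1; unfold p1 q1; field_simp; ring
  · convert hp using 1; unfold p2 q2; field_simp; ring
  · rw [← neg_pos]; convert hp using 1; unfold p3 q1; field_simp; ring
  · rw [← neg_pos]; convert hp using 1; unfold p4 q2; field_simp; ring

lemma Rup_contDiffAt {w : ℝ × ℝ} (h : Good μ δ σ₁ σ₂ w.1 w.2) :
    ContDiffAt ℝ 2 (fun w : ℝ × ℝ => Rup μ δ σ₁ σ₂ w.1 w.2) w := by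
  unfold Rup
  exact (((Hf_contDiffAt h.1.ne').neg.add (Hf_contDiffAt h.2.1.ne')).sub (Hf_contDiffAt h.2.2.1.ne)).add
    (Hf_contDiffAt h.2.2.2.ne)

lemma Vform_Rup {x y : ℝ} (hD : 0 < Dq μ δ σ₁ σ₂ x y) (h : Good μ δ σ₁ σ₂ x y) :
    VformE μ δ σ₁ σ₂ x y = 1 - Real.exp (-(al2 μ σ₁ σ₂ * x + al2 μ σ₁ σ₂ * y)) + Rup μ δ σ₁ σ₂ x y := by
  rw [VformE_eq]
  unfold E1 E2 E3 E4 Rup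
  rw [Ef_pos hD h.1, Ef_pos hD h.2.1, Ef_neg hD h.2.2.1, Ef_neg hD h.2.2.2]
  simp only [zero_mul, add_zero, neg_zero, Real.exp_zero]
  ring

lemma Dq_swap (x y : ℝ) : Dq μ δ σ₂ σ₁ y x * σ₂ = - (Dq μ δ σ₁ σ₂ x y * σ₁) := by
  unfold Dq; ring

lemma Vext_contDiffAt (h1 : 0 < σ₁) (h2 : 0 < σ₂) (hk : 0 < μ + δ * (σ₁ + σ₂)) {w : ℝ × ℝ}
    (hx : 0 < w.1) (hy : 0 < w.2) : ContDiffAt ℝ 2 (fun w : ℝ × ℝ => Vext μ δ σ₁ σ₂ w.1 w.2) w := by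
  have hk' : 0 < μ + δ * (σ₂ + σ₁) := by rwa [add_comm σ₂]
  have cD : ∀ σ₁ σ₂, Continuous (fun p : ℝ × ℝ => Dq μ δ σ₁ σ₂ p.1 p.2) := fun _ _ => (Dq_contDiff 0).continuous
  rcases lt_trichotomy (σ₂ / σ₁ * w.1) w.2 with h | h | h
  · have hD := (Dq_pos_iff h1 h2 hk).2 h
    refine (Vform_contDiffAt hD).congr_of_eventuallyEq ?_
    filter_upwards [(cD σ₁ σ₂).continuousAt.eventually (lt_mem_nhds hD)] with w' hw'
    exact Vext_up h1 h2 hk hw'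
  · have g1 := good_diag h1 h2 hk hx h
    have g2 : Good μ δ σ₂ σ₁ w.2 w.1 := good_diag h2 h1 hk' hy (by rw [← h]; field_simp)
    have e : ContDiffAt ℝ 2 (fun w : ℝ × ℝ => 1 - Real.exp (-(al2 μ σ₁ σ₂ * w.1 + al2 μ σ₁ σ₂ * w.2))
        + Rup μ δ σ₁ σ₂ w.1 w.2 + Rup μ δ σ₂ σ₁ w.2 w.1) w := by
      have c1 : ContDiffAt ℝ 2 (fun w : ℝ × ℝ => Rup μ δ σ₂ σ₁ w.2 w.1) w :=
        ContDiffAt.comp w (g := fun w : ℝ × ℝ => Rup μ δ σ₂ σ₁ w.1 w.2) (f := Prod.swap)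
          (Rup_contDiffAt (w := w.swap) g2) (contDiff_snd.prodMk contDiff_fst).contDiffAt
      exact ((by fun_prop : ContDiffAt ℝ 2 (fun w : ℝ × ℝ =>
        1 - Real.exp (-(al2 μ σ₁ σ₂ * w.1 + al2 μ σ₁ σ₂ * w.2))) w).add (Rup_contDiffAt g1)).add c1
    refine e.congr_of_eventuallyEq ?_
    have g2' : ∀ᶠ w' in nhds w, Good μ δ σ₂ σ₁ w'.2 w'.1 :=
      (continuous_swap.continuousAt (x := w)).eventually (good_open (w := w.swap) g2)
    filter_upwards [good_open g1, g2'] with w' a1 a2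
    have hsw := Dq_swap (μ := μ) (δ := δ) (σ₁ := σ₁) (σ₂ := σ₂) w'.1 w'.2
    rcases lt_trichotomy (σ₂ / σ₁ * w'.1) w'.2 with h' | h' | h'
    · have hD := (Dq_pos_iff h1 h2 hk).2 h'
      rw [Vext_up h1 h2 hk hD, Vform_Rup hD a1, Rup_zero (σ₁ := σ₂), add_zero]
      by_contra hc
      nlinarith [mul_pos (not_le.1 hc) h2, mul_pos hD h1]
    · have hD : Dq μ δ σ₁ σ₂ w'.1 w'.2 = 0 := by rw [← h']; unfold Dq; field_simp; ring
      rw [hD, zero_mul, neg_zero] at hsw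
      rw [Rup_zero hD.le, Rup_zero ((mul_eq_zero.1 hsw).resolve_right h2.ne').le, ← h', Vext_diag _ h1 h2]
      ring
    · have hD := (Dq_swap_pos_iff h1 h2 hk).2 h'
      rw [Vext_down h1 h2 hk hD, Vform_Rup hD a2, Rup_zero (σ₁ := σ₁) (σ₂ := σ₂)]
      · have : al2 μ σ₂ σ₁ = al2 μ σ₁ σ₂ := by unfold al2; rw [add_comm]
        rw [this, add_zero, add_comm (al2 μ σ₁ σ₂ * w'.2)]
      by_contra hc
      nlinarith [mul_pos (not_le.1 hc) h1, mul_pos hD h2]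
  · have hD := (Dq_swap_pos_iff h1 h2 hk).2 h
    have c1 : ContDiffAt ℝ 2 (fun w : ℝ × ℝ => VformE μ δ σ₂ σ₁ w.2 w.1) w :=
        ContDiffAt.comp w (g := fun w : ℝ × ℝ => VformE μ δ σ₂ σ₁ w.1 w.2) (f := Prod.swap)
          (Vform_contDiffAt (w := w.swap) hD) (contDiff_snd.prodMk contDiff_fst).contDiffAt
    refine c1.congr_of_eventuallyEq ?_
    filter_upwards [((cD σ₂ σ₁).comp continuous_swap).continuousAt.eventually (lt_mem_nhds hD)] with w' hw'
    exact Vext_down h1 h2 hk hw'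

end

section partials

lemma pd_x {f : ℝ × ℝ → ℝ} {p : ℝ × ℝ} (hf : DifferentiableAt ℝ f p) :
    deriv (fun x' => f (x', p.2)) p.1 = fderiv ℝ f p (1, 0) :=
  (HasFDerivAt.comp_hasDerivAt (f := fun x' => (x', p.2)) p.1 hf.hasFDerivAt
    ((hasDerivAt_id p.1).prodMk (hasDerivAt_const p.1 p.2))).deriv

lemma pd_y {f : ℝ × ℝ → ℝ} {p : ℝ × ℝ} (hf : DifferentiableAt ℝ f p) :
    deriv (fun y' => f (p.1, y')) p.2 = fderiv ℝ f p (0, 1) :=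
  (HasFDerivAt.comp_hasDerivAt (f := fun y' => (p.1, y')) p.2 hf.hasFDerivAt
    ((hasDerivAt_const p.2 p.1).prodMk (hasDerivAt_id p.2))).deriv

lemma pdx_contDiffOn {f : ℝ × ℝ → ℝ} {Q : Set (ℝ × ℝ)} (hQ : IsOpen Q) {m n : WithTop ℕ∞}
    (hf : ContDiffOn ℝ n f Q) (hmn : m + 1 ≤ n) :
    ContDiffOn ℝ m (fun p => deriv (fun x' => f (x', p.2)) p.1) Q := by
  have h1 : ContDiffOn ℝ m (fun p => fderiv ℝ f p (1, 0)) Q :=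
    (hf.fderiv_of_isOpen hQ hmn).clm_apply contDiffOn_const
  refine h1.congr fun p hp => pd_x ?_
  have : n ≠ 0 := by rintro rfl; simp at hmn
  exact (hf.contDiffAt (hQ.mem_nhds hp)).differentiableAt this

lemma pdy_contDiffOn {f : ℝ × ℝ → ℝ} {Q : Set (ℝ × ℝ)} (hQ : IsOpen Q) {m n : WithTop ℕ∞}
    (hf : ContDiffOn ℝ n f Q) (hmn : m + 1 ≤ n) :
    ContDiffOn ℝ m (fun p => deriv (fun y' => f (p.1, y')) p.2) Q := by
  have h1 : ContDiffOn ℝ m (fun p => fderiv ℝ f p (0, 1)) Q :=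
    (hf.fderiv_of_isOpen hQ hmn).clm_apply contDiffOn_const
  refine h1.congr fun p hp => pd_y ?_
  have : n ≠ 0 := by rintro rfl; simp at hmn
  exact (hf.contDiffAt (hQ.mem_nhds hp)).differentiableAt this

lemma pd_symm {f : ℝ × ℝ → ℝ} {Q : Set (ℝ × ℝ)} (hQ : IsOpen Q)
    (hf : ContDiffOn ℝ 2 f Q) {x y : ℝ} (hp : (x, y) ∈ Q) :
    deriv (fun y' => deriv (fun x' => f (x', y')) x) y = deriv (fun x' => deriv (fun y' => f (x', y')) y) x := by
  have hd : ∀ p ∈ Q, DifferentiableAt ℝ f p := fun p hp =>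
    (hf.contDiffAt (hQ.mem_nhds hp)).differentiableAt (by norm_num)
  have hdd : DifferentiableAt ℝ (fderiv ℝ f) (x, y) :=
    ((hf.fderiv_of_isOpen (m := 1) hQ (by norm_num)).contDiffAt (hQ.mem_nhds hp)).differentiableAt (by norm_num)
  have ex : (fun p : ℝ × ℝ => deriv (fun x' => f (x', p.2)) p.1) =ᶠ[nhds (x, y)] fun p => fderiv ℝ f p (1, 0) := by
    filter_upwards [hQ.mem_nhds hp] with p hp using pd_x (hd p hp)
  have ey : (fun p : ℝ × ℝ => deriv (fun y' => f (p.1, y')) p.2) =ᶠ[nhds (x, y)] fun p => fderiv ℝ f p (0, 1) := by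
    filter_upwards [hQ.mem_nhds hp] with p hp using pd_y (hd p hp)
  have dx : DifferentiableAt ℝ (fun p => fderiv ℝ f p (1, 0)) (x, y) := hdd.clm_apply (differentiableAt_const _)
  have dy : DifferentiableAt ℝ (fun p => fderiv ℝ f p (0, 1)) (x, y) := hdd.clm_apply (differentiableAt_const _)
  have l1 := pd_y (p := (x, y)) (dx.congr_of_eventuallyEq ex)
  have l2 := pd_x (p := (x, y)) (dy.congr_of_eventuallyEq ey)
  rw [ex.fderiv_eq] at l1
  rw [ey.fderiv_eq] at l2
  simp only at l1 l2
  rw [l1, l2, fderiv_clm_apply hdd (differentiableAt_const _), fderiv_clm_apply hdd (differentiableAt_const _)]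
  have hs : IsSymmSndFDerivAt ℝ f (x, y) :=
    (hf.contDiffAt (hQ.mem_nhds hp)).isSymmSndFDerivAt (by simp)
  simp [hs.eq (1, 0) (0, 1)]

end partials

section
variable {μ δ σ₁ σ₂ : ℝ}

lemma Q_open : IsOpen (Set.Ioi (0 : ℝ) ×ˢ Set.Ioi (0 : ℝ)) := isOpen_Ioi.prod isOpen_Ioi

lemma Vext_contDiffOn (h1 : 0 < σ₁) (h2 : 0 < σ₂) (hk : 0 < μ + δ * (σ₁ + σ₂)) :
    ContDiffOn ℝ 2 (fun p : ℝ × ℝ => Vext μ δ σ₁ σ₂ p.1 p.2) (Set.Ioi (0 : ℝ) ×ˢ Set.Ioi (0 : ℝ)) :=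
  fun _ hp => (Vext_contDiffAt h1 h2 hk hp.1 hp.2).contDiffWithinAt

lemma Dq_cont_x (y : ℝ) : Continuous (fun x => Dq μ δ σ₁ σ₂ x y) := by unfold Dq; fun_prop
lemma Dq_cont_y (x : ℝ) : Continuous (fun y => Dq μ δ σ₁ σ₂ x y) := by unfold Dq; fun_prop

lemma Vx_up (h1 : 0 < σ₁) (h2 : 0 < σ₂) (hk : 0 < μ + δ * (σ₁ + σ₂)) {x y : ℝ}
    (hD : 0 < Dq μ δ σ₁ σ₂ x y) : VxE μ δ σ₁ σ₂ x y =
      al2 μ σ₁ σ₂ * E2 μ δ σ₁ σ₂ x y + al3 μ δ σ₁ σ₂ * E3 μ δ σ₁ σ₂ x y - al4 μ δ σ₁ σ₂ * E4 μ δ σ₁ σ₂ x y := by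
  unfold VxE
  have e : (fun x' => Vext μ δ σ₁ σ₂ x' y) =ᶠ[nhds x] fun x' => VformE μ δ σ₁ σ₂ x' y := by
    filter_upwards [(Dq_cont_x y).continuousAt.eventually (lt_mem_nhds hD)] with x' hx'
    exact Vext_up h1 h2 hk hx'
  rw [e.deriv_eq, (Vform_d (X := fun x => x) (Y := fun _ => y) (t := x) h1 h2 hD (hasDerivAt_id x) (hasDerivAt_const x y)).deriv]
  ring

lemma Vy_up (h1 : 0 < σ₁) (h2 : 0 < σ₂) (hk : 0 < μ + δ * (σ₁ + σ₂)) {x y : ℝ}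
    (hD : 0 < Dq μ δ σ₁ σ₂ x y) : VyE μ δ σ₁ σ₂ x y =
      al2 μ σ₁ σ₂ * E2 μ δ σ₁ σ₂ x y - al2 μ σ₁ σ₂ * E4 μ δ σ₁ σ₂ x y := by
  unfold VyE
  have e : (fun y' => Vext μ δ σ₁ σ₂ x y') =ᶠ[nhds y] fun y' => VformE μ δ σ₁ σ₂ x y' := by
    filter_upwards [(Dq_cont_y x).continuousAt.eventually (lt_mem_nhds hD)] with x' hx'
    exact Vext_up h1 h2 hk hx'
  rw [e.deriv_eq, (Vform_d (X := fun _ => x) (Y := fun y => y) (t := y) h1 h2 hD (hasDerivAt_const y x) (hasDerivAt_id y)).deriv]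
  ring

/-- The linear pde expression. -/
noncomputable def Lop (μ δ σ₁ σ₂ x y : ℝ) : ℝ :=
  σ₁ ^ 2 / 2 * VxxE μ δ σ₁ σ₂ x y + σ₂ ^ 2 / 2 * VyyE μ δ σ₁ σ₂ x y + σ₁ * σ₂ * VxyE μ δ σ₁ σ₂ x y
    + ((μ + δ * σ₂) * VxE μ δ σ₁ σ₂ x y + (μ - (μ + δ * σ₂)) * VyE μ δ σ₁ σ₂ x y)

lemma Lop_up (h1 : 0 < σ₁) (h2 : 0 < σ₂) (hk : 0 < μ + δ * (σ₁ + σ₂)) {x y : ℝ}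
    (hD : 0 < Dq μ δ σ₁ σ₂ x y) : Lop μ δ σ₁ σ₂ x y = 0 := by
  have ux := (Dq_cont_x y).continuousAt.eventually (lt_mem_nhds hD)
  have uy := (Dq_cont_y x).continuousAt.eventually (lt_mem_nhds hD)
  have hx1 := hasDerivAt_id' x
  have hx0 := hasDerivAt_const x y
  have hy1 := hasDerivAt_id' y
  have hy0 := hasDerivAt_const y x
  have exx : (fun x' => VxE μ δ σ₁ σ₂ x' y) =ᶠ[nhds x] _ := ux.mono fun x' hx' => Vx_up h1 h2 hk hx'
  have dxx := ((((E2_d (X := fun x => x) (Y := fun _ => y) (t := x) h1 h2 hD hx1 hx0).const_mul (al2 μ σ₁ σ₂)).add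
      ((E3_d (X := fun x => x) (Y := fun _ => y) (t := x) h1 h2 hD hx1 hx0).const_mul (al3 μ δ σ₁ σ₂))).sub
      ((E4_d (X := fun x => x) (Y := fun _ => y) (t := x) h1 h2 hD hx1 hx0).const_mul (al4 μ δ σ₁ σ₂))).deriv
  have xx := exx.deriv_eq.trans dxx
  change VxxE μ δ σ₁ σ₂ x y = _ at xx
  have exy : (fun y' => VxE μ δ σ₁ σ₂ x y') =ᶠ[nhds y] _ := uy.mono fun x' hx' => Vx_up h1 h2 hk hx'
  have dxy := ((((E2_d (X := fun _ => x) (Y := fun y => y) (t := y) h1 h2 hD hy0 hy1).const_mul (al2 μ σ₁ σ₂)).add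
      ((E3_d (X := fun _ => x) (Y := fun y => y) (t := y) h1 h2 hD hy0 hy1).const_mul (al3 μ δ σ₁ σ₂))).sub
      ((E4_d (X := fun _ => x) (Y := fun y => y) (t := y) h1 h2 hD hy0 hy1).const_mul (al4 μ δ σ₁ σ₂))).deriv
  have xy := exy.deriv_eq.trans dxy
  change VxyE μ δ σ₁ σ₂ x y = _ at xy
  have eyy : (fun y' => VyE μ δ σ₁ σ₂ x y') =ᶠ[nhds y] _ := uy.mono fun x' hx' => Vy_up h1 h2 hk hx'
  have dyy := (((E2_d (X := fun _ => x) (Y := fun y => y) (t := y) h1 h2 hD hy0 hy1).const_mul (al2 μ σ₁ σ₂)).sub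
      ((E4_d (X := fun _ => x) (Y := fun y => y) (t := y) h1 h2 hD hy0 hy1).const_mul (al2 μ σ₁ σ₂))).deriv
  have yy := eyy.deriv_eq.trans dyy
  change VyyE μ δ σ₁ σ₂ x y = _ at yy
  unfold Lop
  rw [xx, xy, yy, Vx_up h1 h2 hk hD, Vy_up h1 h2 hk hD]
  have := pde_alg h1 h2 hD (E2 μ δ σ₁ σ₂ x y) (E3 μ δ σ₁ σ₂ x y) (E4 μ δ σ₁ σ₂ x y) (gg μ δ σ₁ σ₂ x y)
  linear_combination this

lemma Vxy_up (hμ : 0 < μ) (h1 : 0 < σ₁) (h2 : 0 < σ₂) (hk : 0 < μ + δ * (σ₁ + σ₂)) {x y : ℝ} (hx : 0 ≤ x)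
    (hD : 0 < Dq μ δ σ₁ σ₂ x y) : 0 ≤ VxE μ δ σ₁ σ₂ x y - VyE μ δ σ₁ σ₂ x y := by
  rw [Vx_up h1 h2 hk hD, Vy_up h1 h2 hk hD]
  have := key_ineq hμ h1 h2 hk hx hD
  linarith

lemma up_closed (hμ : 0 < μ) (h1 : 0 < σ₁) (h2 : 0 < σ₂) (hk : 0 < μ + δ * (σ₁ + σ₂)) {x y : ℝ} (hx : 0 < x)
    (hy : 0 < y) (h : σ₂ / σ₁ * x ≤ y) :
    Lop μ δ σ₁ σ₂ x y = 0 ∧ 0 ≤ VxE μ δ σ₁ σ₂ x y - VyE μ δ σ₁ σ₂ x y := by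
  have c0 := Vext_contDiffOn h1 h2 hk
  have cx : ContDiffOn ℝ 1 (fun p : ℝ × ℝ => VxE μ δ σ₁ σ₂ p.1 p.2) _ :=
    pdx_contDiffOn Q_open c0 (m := 1) (by norm_num)
  have cy : ContDiffOn ℝ 1 (fun p : ℝ × ℝ => VyE μ δ σ₁ σ₂ p.1 p.2) _ :=
    pdy_contDiffOn Q_open c0 (m := 1) (by norm_num)
  have cxx : ContDiffOn ℝ 0 (fun p : ℝ × ℝ => VxxE μ δ σ₁ σ₂ p.1 p.2) _ :=
    pdx_contDiffOn Q_open cx (m := 0) (by norm_num)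
  have cxy : ContDiffOn ℝ 0 (fun p : ℝ × ℝ => VxyE μ δ σ₁ σ₂ p.1 p.2) _ :=
    pdy_contDiffOn Q_open cx (m := 0) (by norm_num)
  have cyy : ContDiffOn ℝ 0 (fun p : ℝ × ℝ => VyyE μ δ σ₁ σ₂ p.1 p.2) _ :=
    pdy_contDiffOn Q_open cy (m := 0) (by norm_num)
  have key : ∀ f : ℝ × ℝ → ℝ, ContinuousOn f (Set.Ioi (0 : ℝ) ×ˢ Set.Ioi (0 : ℝ)) →
      Tendsto (fun y' => f (x, y')) (nhdsWithin y (Set.Ioi y)) (nhds (f (x, y))) := fun f hf => by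
    have a : ContinuousAt f (x, y) := hf.continuousAt (Q_open.mem_nhds ⟨hx, hy⟩)
    have b : ContinuousAt (fun y' => f (x, y')) y :=
      ContinuousAt.comp (f := fun y' : ℝ => (x, y')) a (by fun_prop)
    exact b.tendsto.mono_left nhdsWithin_le_nhds
  have hup : ∀ y' ∈ Set.Ioi y, 0 < Dq μ δ σ₁ σ₂ x y' := fun y' hy' =>
    (Dq_pos_iff h1 h2 hk).2 (lt_of_le_of_lt h hy')
  constructor
  · have t := key (fun p => Lop μ δ σ₁ σ₂ p.1 p.2) (by
      unfold Lop
      exact (((cxx.continuousOn.const_mul _).add (cyy.continuousOn.const_mul _)).add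
        (cxy.continuousOn.const_mul _)).add ((cx.continuousOn.const_mul _).add (cy.continuousOn.const_mul _)))
    refine tendsto_nhds_unique t (tendsto_const_nhds.congr' ?_)
    filter_upwards [self_mem_nhdsWithin] with y' hy'
    exact (Lop_up h1 h2 hk (hup y' hy')).symm
  · have t := key (fun p => VxE μ δ σ₁ σ₂ p.1 p.2 - VyE μ δ σ₁ σ₂ p.1 p.2) (cx.continuousOn.sub cy.continuousOn)
    refine ge_of_tendsto t ?_
    filter_upwards [self_mem_nhdsWithin] with y' hy'
    exact Vxy_up hμ h1 h2 hk hx.le (hup y' hy')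

lemma sSup_lin {a b c d m : ℝ} (hab : a ≤ b) (h : d ≤ c) :
    sSup ((fun t => t * c + (m - t) * d) '' Set.Icc a b) = b * c + (m - b) * d := by
  apply IsGreatest.csSup_eq
  refine ⟨⟨b, ⟨hab, le_rfl⟩, rfl⟩, ?_⟩
  rintro _ ⟨t, ht, rfl⟩
  simp only
  nlinarith [mul_nonneg (sub_nonneg.2 ht.2) (sub_nonneg.2 h)]

lemma sSup_lin' {a b c d m : ℝ} (hab : a ≤ b) (h : c ≤ d) :
    sSup ((fun t => t * c + (m - t) * d) '' Set.Icc a b) = a * c + (m - a) * d := by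
  apply IsGreatest.csSup_eq
  refine ⟨⟨a, ⟨le_rfl, hab⟩, rfl⟩, ?_⟩
  rintro _ ⟨t, ht, rfl⟩
  simp only
  nlinarith [mul_nonneg (sub_nonneg.2 ht.1) (sub_nonneg.2 h)]

lemma hjb (hμ : 0 < μ) (h1 : 0 < σ₁) (h2 : 0 < σ₂) (hk : 0 < μ + δ * (σ₁ + σ₂)) {x y : ℝ} (hx : 0 < x)
    (hy : 0 < y) :
    σ₁ ^ 2 / 2 * VxxE μ δ σ₁ σ₂ x y + σ₂ ^ 2 / 2 * VyyE μ δ σ₁ σ₂ x y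
          + σ₁ * σ₂ * VxyE μ δ σ₁ σ₂ x y
          + sSup ((fun a => a * VxE μ δ σ₁ σ₂ x y + (μ - a) * VyE μ δ σ₁ σ₂ x y) ''
              Set.Icc (-(δ * σ₁)) (μ + δ * σ₂)) = 0 := by
  have hk' : 0 < μ + δ * (σ₂ + σ₁) := by rwa [add_comm σ₂]
  have hab : -(δ * σ₁) ≤ μ + δ * σ₂ := by linarith
  rcases le_total (σ₂ / σ₁ * x) y with h | h
  · obtain ⟨a, b⟩ := up_closed hμ h1 h2 hk hx hy h
    rw [sSup_lin hab (by linarith)]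
    exact a
  · have h' : σ₁ / σ₂ * y ≤ x := by
      rw [div_mul_eq_mul_div, div_le_iff₀ h2]
      rw [div_mul_eq_mul_div, le_div_iff₀ h1] at h
      linarith
    obtain ⟨a, b⟩ := up_closed hμ h2 h1 hk' hy hx h'
    have sw := Vext_swap h1 h2 hk
    have ex : ∀ x y, VxE μ δ σ₂ σ₁ y x = VyE μ δ σ₁ σ₂ x y := fun x y => by
      unfold VxE VyE; simp only [sw]
    have ey : ∀ x y, VyE μ δ σ₂ σ₁ y x = VxE μ δ σ₁ σ₂ x y := fun x y => by
      unfold VxE VyE; simp only [sw]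
    have exx : VxxE μ δ σ₂ σ₁ y x = VyyE μ δ σ₁ σ₂ x y := by
      unfold VxxE VyyE; simp only [ex]
    have eyy : VyyE μ δ σ₂ σ₁ y x = VxxE μ δ σ₁ σ₂ x y := by
      unfold VxxE VyyE; simp only [ey]
    have exy : VxyE μ δ σ₂ σ₁ y x = VxyE μ δ σ₁ σ₂ x y := by
      unfold VxyE; simp only [ex]
      exact (pd_symm Q_open (Vext_contDiffOn h1 h2 hk) (x := x) (y := y) ⟨hx, hy⟩).symm
    unfold Lop at a
    rw [ex, ey, exx, eyy, exy] at a
    rw [ex, ey] at b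
    rw [sSup_lin' hab (by linarith)]
    linear_combination a

end

section
variable {μ δ σ₁ σ₂ : ℝ}

open Classical in
noncomputable def Vbar (μ δ σ₁ σ₂ : ℝ) (p : ℝ × ℝ) : ℝ :=
  if 0 < p.1 ∧ 0 < p.2 then Vext μ δ σ₁ σ₂ p.1 p.2 else 0

lemma Vbar_pos {p : ℝ × ℝ} (hx : 0 < p.1) (hy : 0 < p.2) : Vbar μ δ σ₁ σ₂ p = Vext μ δ σ₁ σ₂ p.1 p.2 := by
  unfold Vbar; rw [if_pos ⟨hx, hy⟩]

lemma Vbar_x {p : ℝ × ℝ} (hx : p.1 ≤ 0) : Vbar μ δ σ₁ σ₂ p = 0 := by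
  unfold Vbar; rw [if_neg (fun h => absurd h.1 (not_lt.2 hx))]

lemma Vbar_y {p : ℝ × ℝ} (hx : p.2 ≤ 0) : Vbar μ δ σ₁ σ₂ p = 0 := by
  unfold Vbar; rw [if_neg (fun h => absurd h.2 (not_lt.2 hx))]

lemma Vbar_swap (h1 : 0 < σ₁) (h2 : 0 < σ₂) (hk : 0 < μ + δ * (σ₁ + σ₂)) (p : ℝ × ℝ) :
    Vbar μ δ σ₁ σ₂ p = Vbar μ δ σ₂ σ₁ p.swap := by
  unfold Vbar
  simp only [Prod.fst_swap, Prod.snd_swap, and_comm (a := 0 < p.2), Vext_swap h1 h2 hk p.1 p.2]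

lemma Vform_zero (y : ℝ) : VformE μ δ σ₁ σ₂ 0 y = 0 := by
  rw [VformE_eq]; unfold E1 E2 E3 E4 Ef; simp

lemma Vbar_cont_pos (h1 : 0 < σ₁) (h2 : 0 < σ₂) (hk : 0 < μ + δ * (σ₁ + σ₂)) {p : ℝ × ℝ} (hx : 0 < p.1)
    (hy : 0 < p.2) : ContinuousAt (Vbar μ δ σ₁ σ₂) p := by
  refine (Vext_contDiffAt h1 h2 hk hx hy).continuousAt.congr ?_
  filter_upwards [Q_open.mem_nhds (show p ∈ Set.Ioi (0 : ℝ) ×ˢ Set.Ioi (0 : ℝ) from ⟨hx, hy⟩)] with q hq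
  exact (Vbar_pos hq.1 hq.2).symm

lemma Vbar_cont_y (h1 : 0 < σ₁) (h2 : 0 < σ₂) (hk : 0 < μ + δ * (σ₁ + σ₂)) {p : ℝ × ℝ} (hx : 0 ≤ p.1)
    (hy : 0 < p.2) : ContinuousWithinAt (Vbar μ δ σ₁ σ₂) (Set.Ici (0 : ℝ) ×ˢ Set.Ici (0 : ℝ)) p := by
  rcases hx.lt_or_eq with hx | hx
  · exact (Vbar_cont_pos h1 h2 hk hx hy).continuousWithinAt
  · have hD : 0 < Dq μ δ σ₁ σ₂ p.1 p.2 := by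
      rw [Dq_pos_iff h1 h2 hk, ← hx]; simpa using hy
    have c := (Vform_contDiffAt hD).continuousAt.continuousWithinAt (s := Set.Ici (0 : ℝ) ×ˢ Set.Ici (0 : ℝ))
    refine c.congr_of_eventuallyEq ?_ ?_
    · have e1 := (Dq_contDiff (μ := μ) (δ := δ) (σ₁ := σ₁) (σ₂ := σ₂) 0).continuous.continuousAt.eventually
        (lt_mem_nhds hD)
      have e2 := continuous_snd.continuousAt.eventually (lt_mem_nhds hy)
      filter_upwards [nhdsWithin_le_nhds e1, nhdsWithin_le_nhds e2, self_mem_nhdsWithin] with q q1 q2 q3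
      have q4 : 0 ≤ q.1 := q3.1
      rcases q4.lt_or_eq with h | h
      · rw [Vbar_pos h q2, Vext_up h1 h2 hk q1]
      · rw [Vbar_x h.symm.le, ← h, Vform_zero]
    · rw [Vbar_x hx.symm.le, ← hx, Vform_zero]

lemma Vbar_bound_up (hμ : 0 < μ) (h1 : 0 < σ₁) (h2 : 0 < σ₂) (hk : 0 < μ + δ * (σ₁ + σ₂)) {x y : ℝ} (hx : 0 < x)
    (hy : 0 < y) (h : σ₂ / σ₁ * x ≤ y) :
    0 ≤ Vext μ δ σ₁ σ₂ x y ∧ Vext μ δ σ₁ σ₂ x y ≤ 1 - Real.exp (-(al2 μ σ₁ σ₂ * (x + y))) := by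
  have hs : 0 < σ₁ + σ₂ := by positivity
  obtain ⟨c, hc⟩ : ∃ c, c = x + y := ⟨_, rfl⟩
  have hc0 : 0 < c := by rw [hc]; positivity
  have hy' : y = c - x := by linarith
  obtain ⟨m, hm⟩ : ∃ m, m = σ₁ * c / (σ₁ + σ₂) := ⟨_, rfl⟩
  have hm0 : 0 < m := by rw [hm]; positivity
  have hmc : m < c := by
    rw [hm, div_lt_iff₀ hs]; nlinarith
  have hiff : ∀ t, t < m → 0 < Dq μ δ σ₁ σ₂ t (c - t) := fun t ht => by
    rw [Dq_pos_iff h1 h2 hk, div_mul_eq_mul_div, div_lt_iff₀ h1]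
    rw [hm, lt_div_iff₀ hs] at ht
    linarith
  have hxm : x ≤ m := by
    rw [hm, le_div_iff₀ hs]
    rw [div_mul_eq_mul_div, div_le_iff₀ h1] at h
    rw [hc]; linarith
  have hcont : ContinuousOn (fun t => Vbar μ δ σ₁ σ₂ (t, c - t)) (Set.Icc 0 m) := by
    intro t ht
    have ht2 : 0 < c - t := by linarith [ht.2]
    refine ContinuousWithinAt.comp (f := fun t : ℝ => (t, c - t)) (t := Set.Ici (0 : ℝ) ×ˢ Set.Ici (0 : ℝ))
      (Vbar_cont_y h1 h2 hk (p := (t, c - t)) ht.1 ht2) (by fun_prop) ?_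
    intro s hs
    exact ⟨hs.1, by have := hs.2; simp only [Set.mem_Ici]; linarith⟩
  have hder : ∀ t ∈ Set.Ioo 0 m, HasDerivAt (fun t => Vbar μ δ σ₁ σ₂ (t, c - t))
      (al3 μ δ σ₁ σ₂ * E3 μ δ σ₁ σ₂ t (c - t)
        - (al4 μ δ σ₁ σ₂ - al2 μ σ₁ σ₂) * E4 μ δ σ₁ σ₂ t (c - t)) t := fun t ht => by
    have hd := Vform_d (X := fun t => t) (Y := fun t => c - t) (t := t) h1 h2 (hiff t ht.2) (hasDerivAt_id' t)
      ((hasDerivAt_id' t).const_sub c)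
    refine (hd.congr_of_eventuallyEq ?_).congr_deriv ?_
    · filter_upwards [isOpen_Ioo.mem_nhds ht] with s hs
      rw [Vbar_pos (p := (s, c - s)) hs.1 (by have := hs.2; simp only; linarith)]
      exact Vext_up h1 h2 hk (hiff s hs.2)
    · ring
  have hmono : MonotoneOn (fun t => Vbar μ δ σ₁ σ₂ (t, c - t)) (Set.Icc 0 m) := by
    apply monotoneOn_of_deriv_nonneg (convex_Icc 0 m) hcont
    · rw [interior_Icc]
      exact fun t ht => (hder t ht).differentiableAt.differentiableWithinAt
    · rw [interior_Icc]
      intro t ht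
      rw [(hder t ht).deriv]
      exact sub_nonneg.2 (key_ineq hμ h1 h2 hk ht.1.le (hiff t ht.2))
  have v0 := hmono ⟨le_rfl, hm0.le⟩ ⟨hx.le, hxm⟩ hx.le
  have vm := hmono ⟨hx.le, hxm⟩ ⟨hm0.le, le_rfl⟩ hxm
  simp only [← hy'] at v0 vm
  rw [Vbar_x (p := (0, c - 0)) le_rfl, Vbar_pos (p := (x, y)) hx hy] at v0
  have hcm : c - m = σ₂ / σ₁ * m := by
    rw [hm]; field_simp; ring
  rw [Vbar_pos (p := (m, c - m)) hm0 (by simp only; linarith), Vbar_pos (p := (x, y)) hx hy] at vm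
  simp only at v0 vm
  refine ⟨v0, vm.trans_eq ?_⟩
  rw [hcm, Vext_diag m h1 h2, ← hcm, ← hc]
  congr 3
  ring

lemma Vbar_bound (hμ : 0 < μ) (h1 : 0 < σ₁) (h2 : 0 < σ₂) (hk : 0 < μ + δ * (σ₁ + σ₂)) {p : ℝ × ℝ}
    (hx : 0 ≤ p.1) (hy : 0 ≤ p.2) :
    0 ≤ Vbar μ δ σ₁ σ₂ p ∧ Vbar μ δ σ₁ σ₂ p ≤ 1 - Real.exp (-(al2 μ σ₁ σ₂ * (p.1 + p.2))) := by
  have hs : 0 < σ₁ + σ₂ := by positivity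
  have hk' : 0 < μ + δ * (σ₂ + σ₁) := by rwa [add_comm σ₂]
  have hn : 0 ≤ 1 - Real.exp (-(al2 μ σ₁ σ₂ * (p.1 + p.2))) := by
    rw [sub_nonneg, Real.exp_le_one_iff, neg_nonpos]
    unfold al2
    positivity
  rcases hx.lt_or_eq with hx | hx
  · rcases hy.lt_or_eq with hy | hy
    · rw [Vbar_pos hx hy]
      rcases le_total (σ₂ / σ₁ * p.1) p.2 with h | h
      · exact Vbar_bound_up hμ h1 h2 hk hx hy h
      · have h' : σ₁ / σ₂ * p.2 ≤ p.1 := by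
          rw [div_mul_eq_mul_div, div_le_iff₀ h2]
          rw [div_mul_eq_mul_div, le_div_iff₀ h1] at h
          linarith
        have := Vbar_bound_up hμ h2 h1 hk' hy hx h'
        have e : al2 μ σ₂ σ₁ = al2 μ σ₁ σ₂ := by unfold al2; rw [add_comm]
        rwa [← Vext_swap h1 h2 hk, e, add_comm p.2] at this
    · rw [Vbar_y hy.symm.le]; exact ⟨le_rfl, hn⟩
  · rw [Vbar_x hx.symm.le]; exact ⟨le_rfl, hn⟩

lemma Vbar_cont (hμ : 0 < μ) (h1 : 0 < σ₁) (h2 : 0 < σ₂) (hk : 0 < μ + δ * (σ₁ + σ₂)) :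
    ContinuousOn (Vbar μ δ σ₁ σ₂) (Set.Ici (0 : ℝ) ×ˢ Set.Ici (0 : ℝ)) := by
  have hk' : 0 < μ + δ * (σ₂ + σ₁) := by rwa [add_comm σ₂]
  rintro p ⟨hx, hy⟩
  have hx' : 0 ≤ p.1 := hx
  have hy' : 0 ≤ p.2 := hy
  rcases hy'.lt_or_eq with hy1 | hy1
  · exact Vbar_cont_y h1 h2 hk hx' hy1
  rcases hx'.lt_or_eq with hx1 | hx1
  · have := Vbar_cont_y h2 h1 hk' (p := p.swap) hy' hx1
    have c := ContinuousWithinAt.comp (f := Prod.swap) (x := p) (s := Set.Ici (0 : ℝ) ×ˢ Set.Ici (0 : ℝ)) this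
      continuous_swap.continuousWithinAt (fun q hq => ⟨hq.2, hq.1⟩)
    exact c.congr (fun q _ => Vbar_swap h1 h2 hk q) (Vbar_swap h1 h2 hk p)
  · unfold ContinuousWithinAt
    rw [Vbar_x hx1.symm.le]
    have t : Tendsto (fun p : ℝ × ℝ => 1 - Real.exp (-(al2 μ σ₁ σ₂ * (p.1 + p.2))))
        (nhdsWithin p (Set.Ici (0 : ℝ) ×ˢ Set.Ici (0 : ℝ))) (nhds 0) := by
      have : ContinuousAt (fun p : ℝ × ℝ => 1 - Real.exp (-(al2 μ σ₁ σ₂ * (p.1 + p.2)))) p := by fun_prop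
      have := this.tendsto.mono_left (nhdsWithin_le_nhds (s := Set.Ici (0 : ℝ) ×ˢ Set.Ici (0 : ℝ)))
      simpa [← hx1, ← hy1] using this
    refine tendsto_of_tendsto_of_tendsto_of_le_of_le' tendsto_const_nhds t ?_ ?_
    · filter_upwards [self_mem_nhdsWithin] with q hq using (Vbar_bound hμ h1 h2 hk hq.1 hq.2).1
    · filter_upwards [self_mem_nhdsWithin] with q hq using (Vbar_bound hμ h1 h2 hk hq.1 hq.2).2

end

theorem stmt17 (μ δ σ₁ σ₂ : ℝ) (hμ : 0 < μ) (hσ₁ : 0 < σ₁) (hσ₂ : 0 < σ₂)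
    (hδ : -(μ / (σ₁ + σ₂)) < δ) :
    ContDiffOn ℝ 2 (fun p : ℝ × ℝ => Vext μ δ σ₁ σ₂ p.1 p.2)
      (Set.Ioi (0 : ℝ) ×ˢ Set.Ioi (0 : ℝ))
    ∧ (∃ Vbar : ℝ × ℝ → ℝ,
        ContinuousOn Vbar (Set.Ici (0 : ℝ) ×ˢ Set.Ici (0 : ℝ))
        ∧ (∀ x y : ℝ, 0 < x → 0 < y → Vbar (x, y) = Vext μ δ σ₁ σ₂ x y)
        ∧ (∀ x : ℝ, 0 ≤ x → Vbar (x, 0) = 0)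
        ∧ (∀ y : ℝ, 0 ≤ y → Vbar (0, y) = 0))
    ∧ (∀ x y : ℝ, 0 < x → 0 < y →
        σ₁ ^ 2 / 2 * VxxE μ δ σ₁ σ₂ x y + σ₂ ^ 2 / 2 * VyyE μ δ σ₁ σ₂ x y
          + σ₁ * σ₂ * VxyE μ δ σ₁ σ₂ x y
          + sSup ((fun a => a * VxE μ δ σ₁ σ₂ x y + (μ - a) * VyE μ δ σ₁ σ₂ x y) ''
              Set.Icc (-(δ * σ₁)) (μ + δ * σ₂))
          = 0) := by
  have hk : 0 < μ + δ * (σ₁ + σ₂) := by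
    have hs : 0 < σ₁ + σ₂ := by positivity
    rw [← neg_div, div_lt_iff₀ hs] at hδ
    linarith
  refine ⟨Vext_contDiffOn hσ₁ hσ₂ hk, ⟨Vbar μ δ σ₁ σ₂, Vbar_cont hμ hσ₁ hσ₂ hk, ?_, ?_, ?_⟩, ?_⟩
  · intro x y hx hy
    exact Vbar_pos (p := (x, y)) hx hy
  · intro x _
    exact Vbar_y (p := (x, 0)) le_rfl
  · intro y _
    exact Vbar_x (p := (0, y)) le_rfl
  · intro x y hx hy
    exact hjb hμ hσ₁ hσ₂ hk hx hy
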